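/- arXiv:1912.04215 — 2 statements merged into one kernel-verified Lean document; each statement's English description precedes it below -/
import Mathlib

section
/- Let p ∈ [2,∞). There exists a constant C ∈ (0,∞) such that for every n ∈ ℕ with δ = T/n ∈ (0,1), the Euler–Maruyama scheme satisfies E[ sup_{t ∈ [0,T]} |X^{(δ)}_t|^p ] ≤ C. -/
open MeasureTheory ProbabilityTheory

/-- Grid values of the Euler–Maruyama scheme with step size `δ` and initial value `x`. -/
noncomputable def emGrid {Ω : Type*} (μ σ ρ : ℝ → ℝ) (W N : ℝ → Ω → ℝ)
    (δ : ℝ) (x : ℝ) : ℕ → Ω → ℝ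
  | 0, _ => x
  | (j + 1), ω =>
      emGrid μ σ ρ W N δ x j ω
        + μ (emGrid μ σ ρ W N δ x j ω) * δ
        + σ (emGrid μ σ ρ W N δ x j ω) * (W (((j : ℝ) + 1) * δ) ω - W ((j : ℝ) * δ) ω)
        + ρ (emGrid μ σ ρ W N δ x j ω) * (N (((j : ℝ) + 1) * δ) ω - N ((j : ℝ) * δ) ω)

/-- The last grid point `t̲ = δ ⌊t/δ⌋` before time `t`. -/
noncomputable def lastGrid (δ t : ℝ) : ℝ := (⌊t / δ⌋.toNat : ℝ) * δ

/-- The continuous-time Euler–Maruyama scheme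
`X_t = X_t̲ + μ(X_t̲)(t - t̲) + σ(X_t̲)(W_t - W_t̲) + ρ(X_t̲)(N_t - N_t̲)`. -/
noncomputable def emProc {Ω : Type*} (μ σ ρ : ℝ → ℝ) (W N : ℝ → Ω → ℝ)
    (δ : ℝ) (x : ℝ) (t : ℝ) (ω : Ω) : ℝ :=
  emGrid μ σ ρ W N δ x (⌊t / δ⌋.toNat) ω
    + μ (emGrid μ σ ρ W N δ x (⌊t / δ⌋.toNat) ω) * (t - lastGrid δ t)
    + σ (emGrid μ σ ρ W N δ x (⌊t / δ⌋.toNat) ω) * (W t ω - W (lastGrid δ t) ω)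
    + ρ (emGrid μ σ ρ W N δ x (⌊t / δ⌋.toNat) ω) * (N t ω - N (lastGrid δ t) ω)

/-- Bounding function for the noise. -/
noncomputable def hh (M : ℕ) (w v : ℝ) : ℝ := w ^ 2 * (1 + |w|) ^ M + |v| * (1 + |v|) ^ M

lemma hh_nonneg (M : ℕ) (w v : ℝ) : 0 ≤ hh M w v := by unfold hh; positivity

lemma pow_taylor (r : ℕ) (u : ℝ) (hu : 0 ≤ 1 + u) :
    (1 + u) ^ r ≤ 1 + r * u + 2 ^ r * (u ^ 2 * (1 + |u|) ^ r) := by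
  induction r with
  | zero => simp; positivity
  | succ r ih =>
    have h1 : (1 + u) ^ (r + 1) ≤ (1 + r * u + 2 ^ r * (u ^ 2 * (1 + |u|) ^ r)) * (1 + u) := by
      rw [pow_succ]; exact mul_le_mul_of_nonneg_right ih hu
    have h2 : (2:ℝ) ^ r * (u ^ 2 * (1 + |u|) ^ r) * (1 + u)
        ≤ 2 ^ r * (u ^ 2 * (1 + |u|) ^ r) * (1 + |u|) := by
      gcongr; exact le_abs_self u
    have h3 : (r : ℝ) * u ^ 2 ≤ 2 ^ r * (u ^ 2 * (1 + |u|) ^ (r + 1)) := by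
      have a1 : (r : ℝ) ≤ 2 ^ r := by exact_mod_cast (Nat.lt_two_pow_self).le
      have a2 : (1 : ℝ) ≤ (1 + |u|) ^ (r + 1) := one_le_pow₀ (by linarith [abs_nonneg u])
      calc (r : ℝ) * u ^ 2 ≤ 2 ^ r * (u ^ 2 * 1) := by rw [mul_one]; gcongr
        _ ≤ _ := by gcongr
    push_cast
    rw [pow_succ (1 + |u|), pow_succ (2 : ℝ)] at *
    nlinarith

lemma three_max (M : ℕ) (a b c : ℝ) (ha : 0 ≤ a) (hb : 0 ≤ b) (hc : 0 ≤ c) :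
    (a + b + c) ^ 2 * (1 + (a + b + c)) ^ M
      ≤ 3 ^ (M + 2) * (a ^ 2 * (1 + a) ^ M + b ^ 2 * (1 + b) ^ M + c ^ 2 * (1 + c) ^ M) := by
  have key : ∀ d : ℝ, 0 ≤ d → a ≤ d → b ≤ d → c ≤ d →
      (a + b + c) ^ 2 * (1 + (a + b + c)) ^ M ≤ 3 ^ (M + 2) * (d ^ 2 * (1 + d) ^ M) := by
    intro d hd h1 h2 h3
    calc (a + b + c) ^ 2 * (1 + (a + b + c)) ^ M ≤ (3 * d) ^ 2 * (3 * (1 + d)) ^ M := by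
          gcongr <;> linarith
      _ = _ := by rw [mul_pow, mul_pow]; ring
  have pa : 0 ≤ a ^ 2 * (1 + a) ^ M := by positivity
  have pb : 0 ≤ b ^ 2 * (1 + b) ^ M := by positivity
  have pc : 0 ≤ c ^ 2 * (1 + c) ^ M := by positivity
  have p3 : (0:ℝ) < 3 ^ (M + 2) := by positivity
  rcases le_total a b with h | h <;> rcases le_total b c with h' | h' <;>
    rcases le_total a c with h'' | h''
  all_goals first
    | (refine (key a ha le_rfl (by linarith) (by linarith)).trans ?_
       gcongr; linarith)
    | (refine (key b hb (by linarith) le_rfl (by linarith)).trans ?_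
       gcongr; linarith)
    | (refine (key c hc (by linarith) (by linarith) le_rfl).trans ?_
       gcongr; linarith)

lemma u_bounds (K x m s q d w v : ℝ) (hK : 1 ≤ K) (hd : 0 ≤ d)
    (hm : |m| ≤ K * (1 + |x|)) (hs : |s| ≤ K * (1 + |x|)) (hq : |q| ≤ K * (1 + |x|)) :
    |(2 * x * (m * d + q * v)) / (1 + x ^ 2)| ≤ 4 * K * (d + |v|) ∧
    |(2 * x * (s * w)) / (1 + x ^ 2)| ≤ 4 * K * |w| ∧
    (m * d + s * w + q * v) ^ 2 / (1 + x ^ 2) ≤ 2 * K ^ 2 * (d + |w| + |v|) ^ 2 := by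
  have hg : 0 < 1 + x ^ 2 := by positivity
  have hx : |x| * (1 + |x|) ≤ 2 * (1 + x ^ 2) := by
    have := sq_abs x; nlinarith [sq_nonneg (|x| - 1), abs_nonneg x]
  have hx2 : (1 + |x|) ^ 2 ≤ 2 * (1 + x ^ 2) := by
    have := sq_abs x; nlinarith [sq_nonneg (|x| - 1), abs_nonneg x]
  have b1 : |m * d + q * v| ≤ K * (1 + |x|) * (d + |v|) := by
    calc |m * d + q * v| ≤ |m * d| + |q * v| := abs_add_le _ _
      _ = |m| * d + |q| * |v| := by rw [abs_mul, abs_mul, abs_of_nonneg hd]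
      _ ≤ K * (1 + |x|) * d + K * (1 + |x|) * |v| := by gcongr
      _ = _ := by ring
  have b2 : |s * w| ≤ K * (1 + |x|) * |w| := by rw [abs_mul]; gcongr
  refine ⟨?_, ?_, ?_⟩
  · rw [abs_div, abs_of_pos hg, div_le_iff₀ hg, abs_mul, abs_mul, abs_two]
    calc 2 * |x| * |m * d + q * v| ≤ 2 * |x| * (K * (1 + |x|) * (d + |v|)) := by gcongr
      _ = 2 * K * (d + |v|) * (|x| * (1 + |x|)) := by ring
      _ ≤ 2 * K * (d + |v|) * (2 * (1 + x ^ 2)) := by gcongr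
      _ = _ := by ring
  · rw [abs_div, abs_of_pos hg, div_le_iff₀ hg, abs_mul, abs_mul, abs_two]
    calc 2 * |x| * |s * w| ≤ 2 * |x| * (K * (1 + |x|) * |w|) := by gcongr
      _ = 2 * K * |w| * (|x| * (1 + |x|)) := by ring
      _ ≤ 2 * K * |w| * (2 * (1 + x ^ 2)) := by gcongr
      _ = _ := by ring
  · rw [div_le_iff₀ hg, ← sq_abs]
    have b3 : |m * d + s * w + q * v| ≤ K * (1 + |x|) * (d + |w| + |v|) := by
      have : m * d + s * w + q * v = (m * d + q * v) + s * w := by ring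
      rw [this]
      refine (abs_add_le _ _).trans ?_
      linarith
    calc |m * d + s * w + q * v| ^ 2 ≤ (K * (1 + |x|) * (d + |w| + |v|)) ^ 2 := by gcongr
      _ = K ^ 2 * (d + |w| + |v|) ^ 2 * (1 + |x|) ^ 2 := by ring
      _ ≤ K ^ 2 * (d + |w| + |v|) ^ 2 * (2 * (1 + x ^ 2)) := by gcongr
      _ = _ := by ring

set_option maxHeartbeats 1000000 in
/-- Two-sided one-step expansion. -/
lemma one_step (K T : ℝ) (hK : 1 ≤ K) (hT : 0 ≤ T) (r : ℕ) : ∃ C : ℝ, 0 ≤ C ∧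
    ∀ x m s q d w v : ℝ, 0 ≤ d → d ≤ T →
    |m| ≤ K * (1 + |x|) → |s| ≤ K * (1 + |x|) → |q| ≤ K * (1 + |x|) →
    (1 + (x + m * d + s * w + q * v) ^ 2) ^ r
      ≤ (1 + x ^ 2) ^ r * (1 + (r * (2 * x * s / (1 + x ^ 2))) * w
          + C * (d + hh (2 * r + 3) w v)) ∧
    (1 + x ^ 2) ^ r * (1 + (r * (2 * x * s / (1 + x ^ 2))) * w
          + (-C) * (d + hh (2 * r + 3) w v))
      ≤ (1 + (x + m * d + s * w + q * v) ^ 2) ^ r := by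
  set M := 2 * r + 2 with hM
  set C1 : ℝ := 4 * r * K + r * (2 * K ^ 2) + 2 ^ r * (4 * K ^ 2) ^ (r + 2) with hC1
  set C2 : ℝ := 2 + 3 ^ (M + 2) * (T * (1 + T) ^ M + 1) with hC2
  have hK0 : 0 ≤ K := by linarith
  have hC10 : 0 ≤ C1 := by positivity
  have hC20 : 0 ≤ C2 := by positivity
  refine ⟨C1 * C2, by positivity, ?_⟩
  intro x m s q d w v hd hdT hm hs hq
  obtain ⟨e1, e2, e3⟩ := u_bounds K x m s q d w v hK hd hm hs hq
  have hg : 0 < 1 + x ^ 2 := by positivity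
  set D := m * d + s * w + q * v with hD
  set u1 := (2 * x * (m * d + q * v)) / (1 + x ^ 2) with hu1
  set u2 := (2 * x * (s * w)) / (1 + x ^ 2) with hu2
  set u3 := D ^ 2 / (1 + x ^ 2) with hu3
  have hu30 : 0 ≤ u3 := by positivity
  set u := u1 + u2 + u3 with hu
  have hfac : 1 + (x + m * d + s * w + q * v) ^ 2 = (1 + x ^ 2) * (1 + u) := by
    rw [hu, hu1, hu2, hu3, hD]; field_simp; ring
  have h1u : 0 ≤ 1 + u := by
    have : 0 ≤ (1 + x ^ 2) * (1 + u) := by rw [← hfac]; positivity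
    exact nonneg_of_mul_nonneg_right this hg
  set a := d + |w| + |v| with ha
  have ha0 : 0 ≤ a := by positivity
  set f := a ^ 2 * (1 + a) ^ M with hf
  have hua : |u| ≤ 4 * K ^ 2 * (a * (1 + a)) := by
    calc |u| ≤ |u1| + |u2| + |u3| := abs_add_three _ _ _
      _ ≤ 4 * K * (d + |v|) + 4 * K * |w| + 2 * K ^ 2 * a ^ 2 := by
          rw [abs_of_nonneg hu30]; gcongr
      _ = 4 * K * a + 2 * K ^ 2 * a ^ 2 := by rw [ha]; ring
      _ ≤ 4 * K ^ 2 * a + 4 * K ^ 2 * a ^ 2 := by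
          gcongr
          · nlinarith
          · norm_num
      _ = _ := by ring
  have hua1 : 1 + |u| ≤ 4 * K ^ 2 * (1 + a) ^ 2 := by
    nlinarith [mul_nonneg (sq_nonneg K) ha0]
  have hua2 : u ^ 2 * (1 + |u|) ^ r ≤ (4 * K ^ 2) ^ (r + 2) * f := by
    rw [← sq_abs]
    calc |u| ^ 2 * (1 + |u|) ^ r
        ≤ (4 * K ^ 2 * (a * (1 + a))) ^ 2 * (4 * K ^ 2 * (1 + a) ^ 2) ^ r := by gcongr
      _ = _ := by rw [hf, hM]; simp only [mul_pow, pow_add, ← pow_mul]; ring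
  have ha2f : a ^ 2 ≤ f := by
    rw [hf]; exact le_mul_of_one_le_right (by positivity) (one_le_pow₀ (by linarith))
  have hf0 : 0 ≤ f := by positivity
  have hv1 : |v| ≤ |v| * (1 + |v|) ^ (M + 1) :=
    le_mul_of_one_le_right (by positivity) (one_le_pow₀ (by linarith [abs_nonneg v]))
  have hhdef : hh (2 * r + 3) w v = w ^ 2 * (1 + |w|) ^ (M + 1) + |v| * (1 + |v|) ^ (M + 1) := rfl
  have hvh : |v| ≤ hh (2 * r + 3) w v := by
    rw [hhdef]
    have : 0 ≤ w ^ 2 * (1 + |w|) ^ (M + 1) := by positivity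
    linarith
  have hfh : f ≤ 3 ^ (M + 2) * (T * (1 + T) ^ M * d + hh (2 * r + 3) w v) := by
    refine (three_max M d |w| |v| hd (abs_nonneg _) (abs_nonneg _)).trans ?_
    have t1 : d ^ 2 * (1 + d) ^ M ≤ T * (1 + T) ^ M * d := by
      calc d ^ 2 * (1 + d) ^ M = d * (1 + d) ^ M * d := by ring
        _ ≤ _ := by gcongr
    have t2 : |w| ^ 2 * (1 + |w|) ^ M ≤ w ^ 2 * (1 + |w|) ^ (M + 1) := by
      rw [sq_abs]; gcongr
      · linarith [abs_nonneg w]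
      · omega
    have t3 : |v| ^ 2 * (1 + |v|) ^ M ≤ |v| * (1 + |v|) ^ (M + 1) := by
      calc |v| ^ 2 * (1 + |v|) ^ M = |v| * ((1 + |v|) ^ M * |v|) := by ring
        _ ≤ |v| * ((1 + |v|) ^ M * (1 + |v|)) := by gcongr; linarith
        _ = _ := by ring
    refine mul_le_mul_of_nonneg_left ?_ (by positivity)
    rw [hhdef]; linarith
  have hh0 := hh_nonneg (2 * r + 3) w v
  have hsum : d + |v| + f ≤ C2 * (d + hh (2 * r + 3) w v) := by
    have hB : 0 ≤ T * (1 + T) ^ M := by positivity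
    rw [hC2]
    generalize hh (2 * r + 3) w v = H at *
    generalize T * (1 + T) ^ M = B at *
    have q2 : 3 ^ (M + 2) * (B * d + H) ≤ 3 ^ (M + 2) * ((B + 1) * (d + H)) := by
      refine mul_le_mul_of_nonneg_left ?_ (by positivity)
      linarith [mul_nonneg hB hh0]
    linarith
  have hu2' : u2 = (2 * x * s / (1 + x ^ 2)) * w := by rw [hu2]; ring
  have h1' := abs_le.mp e1
  have hr0 : (0:ℝ) ≤ r := Nat.cast_nonneg r
  have hpos : 0 ≤ d + |v| := by positivity
  have hfin : C1 * (d + |v| + f) ≤ C1 * C2 * (d + hh (2 * r + 3) w v) := by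
    rw [mul_assoc]; gcongr
  rw [hfac, mul_pow]
  constructor
  · refine mul_le_mul_of_nonneg_left ?_ (by positivity)
    refine (pow_taylor r u h1u).trans ?_
    have : (2:ℝ) ^ r * (u ^ 2 * (1 + |u|) ^ r) ≤ 2 ^ r * (4 * K ^ 2) ^ (r + 2) * f := by
      rw [mul_assoc]; gcongr
    have h5 : (r:ℝ) * u ≤ r * (4 * K * (d + |v|) + (2 * x * s / (1 + x ^ 2)) * w + 2 * K ^ 2 * f) := by
      refine mul_le_mul_of_nonneg_left ?_ hr0
      rw [hu, ← hu2']
      have : 2 * K ^ 2 * a ^ 2 ≤ 2 * K ^ 2 * f := by gcongr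
      linarith only [this, e3, h1'.2]
    have h5' := h5.trans_eq (show _ = 4 * r * K * (d + |v|)
      + (r * (2 * x * s / (1 + x ^ 2))) * w + r * (2 * K ^ 2) * f by ring)
    have h6 : 4 * r * K * (d + |v|) + r * (2 * K ^ 2) * f + 2 ^ r * (4 * K ^ 2) ^ (r + 2) * f
        ≤ C1 * (d + |v| + f) := by
      have z1 : 0 ≤ 4 * r * K * f := by positivity
      have z2 : 0 ≤ r * (2 * K ^ 2) * (d + |v|) := by positivity
      have z3 : 0 ≤ 2 ^ r * (4 * K ^ 2) ^ (r + 2) * (d + |v|) := by positivity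
      rw [hC1, add_mul, add_mul, mul_add _ (d + |v|), mul_add _ (d + |v|), mul_add _ (d + |v|)]
      linarith only [z1, z2, z3]
    linarith only [this, h5', h6, hfin]
  · refine mul_le_mul_of_nonneg_left ?_ (by positivity)
    refine le_trans ?_ (one_add_mul_le_pow (by linarith) r)
    have h5 : r * (-(4 * K * (d + |v|)) + (2 * x * s / (1 + x ^ 2)) * w) ≤ r * u := by
      refine mul_le_mul_of_nonneg_left ?_ hr0
      rw [hu, ← hu2']; linarith only [h1'.1, hu30]
    have h5' := (show _ = -(4 * r * K * (d + |v|))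
      + (r * (2 * x * s / (1 + x ^ 2))) * w by ring).symm.trans_le h5
    have h6 : 4 * r * K * (d + |v|) ≤ C1 * (d + |v| + f) := by
      have z1 : 0 ≤ 4 * r * K * f := by positivity
      have z2 : 0 ≤ r * (2 * K ^ 2) * (d + |v| + f) := by positivity
      have z3 : 0 ≤ 2 ^ r * (4 * K ^ 2) ^ (r + 2) * (d + |v| + f) := by positivity
      rw [hC1, add_mul, add_mul, mul_add (4 * r * K) (d + |v|)]
      linarith only [z1, z2, z3]
    linarith only [h5', h6, hfin]

lemma lin_growth (μ : ℝ → ℝ) (m : ℕ) (hm : 0 < m) (ζ : Fin m → ℝ) (hζ : StrictMono ζ)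
    (hμ_low : ∃ K : NNReal, LipschitzOnWith K μ (Set.Iio (ζ ⟨0, hm⟩)))
    (hμ_high : ∃ K : NNReal, LipschitzOnWith K μ (Set.Ioi (ζ ⟨m - 1, Nat.sub_lt hm one_pos⟩)))
    (hμ_mid : ∀ (k : Fin m) (h : (k : ℕ) + 1 < m),
      ∃ K : NNReal, LipschitzOnWith K μ (Set.Ioo (ζ k) (ζ ⟨(k : ℕ) + 1, h⟩))) :
    ∃ K : ℝ, ∀ x, |μ x| ≤ K * (1 + |x|) := by
  have good_lip : ∀ A : Set ℝ, (∃ K : NNReal, LipschitzOnWith K μ A) →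
      ∃ K : ℝ, ∀ x ∈ A, |μ x| ≤ K * (1 + |x|) := by
    rintro A ⟨K, hK⟩
    rcases A.eq_empty_or_nonempty with rfl | ⟨y, hy⟩
    · exact ⟨0, by simp⟩
    · refine ⟨|μ y| + K * (1 + |y|), fun x hx => ?_⟩
      have h := hK.dist_le_mul x hx y hy
      rw [Real.dist_eq, Real.dist_eq] at h
      have h1 : |μ x| ≤ |μ y| + |μ x - μ y| := by
        have := abs_add_le (μ y) (μ x - μ y); simpa using this
      have h2 : |x - y| ≤ |x| + |y| := abs_sub _ _
      have h3 : (K:ℝ) * |x - y| ≤ K * (|x| + |y|) := by gcongr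
      have h4 : (K:ℝ) * (|x| + |y|) ≤ K * ((1 + |y|) * (1 + |x|)) := by
        gcongr; nlinarith [abs_nonneg x, abs_nonneg y, mul_nonneg (abs_nonneg x) (abs_nonneg y)]
      have h5 : |μ y| ≤ |μ y| * (1 + |x|) := by nlinarith [abs_nonneg x, abs_nonneg (μ y), mul_nonneg (abs_nonneg x) (abs_nonneg (μ y))]
      nlinarith
  have good_pt : ∀ y : ℝ, ∃ K : ℝ, ∀ x ∈ ({y} : Set ℝ), |μ x| ≤ K * (1 + |x|) := by
    intro y
    refine good_lip _ ⟨0, ?_⟩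
    intro a ha b hb
    rw [Set.mem_singleton_iff] at ha hb
    subst ha; subst hb; simp
  have good_un : ∀ A B : Set ℝ, (∃ K : ℝ, ∀ x ∈ A, |μ x| ≤ K * (1 + |x|)) →
      (∃ K : ℝ, ∀ x ∈ B, |μ x| ≤ K * (1 + |x|)) →
      ∃ K : ℝ, ∀ x ∈ A ∪ B, |μ x| ≤ K * (1 + |x|) := by
    rintro A B ⟨K, hK⟩ ⟨L, hL⟩
    refine ⟨max K L, ?_⟩
    rintro x (hx | hx)
    · exact (hK x hx).trans (by gcongr; exact le_max_left _ _)
    · exact (hL x hx).trans (by gcongr; exact le_max_right _ _)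
  have ind : ∀ k : ℕ, ∀ hk : k < m, ∃ K : ℝ, ∀ x ∈ Set.Iic (ζ ⟨k, hk⟩), |μ x| ≤ K * (1 + |x|) := by
    intro k
    induction k with
    | zero =>
      intro hk
      have := good_un _ _ (good_lip _ hμ_low) (good_pt (ζ ⟨0, hm⟩))
      rwa [Set.Iio_union_right] at this
    | succ k ih =>
      intro hk
      have hk' : k < m := by omega
      have := good_un _ _ (ih hk') (good_un _ _ (good_lip _ (hμ_mid ⟨k, hk'⟩ hk))
        (good_pt (ζ ⟨k + 1, hk⟩)))
      rw [Set.Ioo_union_right (hζ (by simp)), Set.Iic_union_Ioc_eq_Iic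
        (hζ (show (⟨k, hk'⟩ : Fin m) < ⟨k + 1, hk⟩ by simp)).le] at this
      exact this
  obtain ⟨K, hK⟩ := good_un _ _ (ind (m - 1) (Nat.sub_lt hm one_pos)) (good_lip _ hμ_high)
  rw [Set.Iic_union_Ioi] at hK
  exact ⟨K, fun x => hK x (Set.mem_univ x)⟩

lemma gauss_moment (T : ℝ) (hT : 0 ≤ T) (M : ℕ) : ∃ C : ℝ, 0 ≤ C ∧ ∀ d : ℝ, 0 ≤ d → d ≤ T →
    Integrable (fun w : ℝ => w ^ 2 * (1 + |w|) ^ M) (gaussianReal 0 d.toNNReal) ∧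
    ∫ w, w ^ 2 * (1 + |w|) ^ M ∂(gaussianReal 0 d.toNNReal) ≤ C * d := by
  set g := gaussianReal 0 1 with hg
  have hint0 : Integrable (fun x : ℝ => (1 + |x|) ^ (M + 2)) g := by
    have h1 : MemLp (fun x : ℝ => 1 + |x|) ((M + 2 : ℕ) : ENNReal) g := by
      have h2 : MemLp (id : ℝ → ℝ) ((M + 2 : ℕ) : ENNReal) g :=
        memLp_id_gaussianReal' _ (ENNReal.natCast_ne_top _)
      have h3 : MemLp (fun x : ℝ => |x|) ((M + 2 : ℕ) : ENNReal) g := h2.norm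
      have h4 : MemLp (fun _ : ℝ => (1:ℝ)) ((M + 2 : ℕ) : ENNReal) g := memLp_const 1
      exact h4.add h3
    have := h1.integrable_norm_pow (by omega)
    refine this.congr (Filter.Eventually.of_forall fun x => ?_)
    have : 0 ≤ 1 + |x| := by positivity
    simp only [Real.norm_eq_abs, abs_of_nonneg this]
  have hint : Integrable (fun x : ℝ => x ^ 2 * (1 + √T * |x|) ^ M) g := by
    refine (hint0.const_mul ((1 + √T) ^ M)).mono' (by fun_prop) (Filter.Eventually.of_forall fun x => ?_)
    rw [Real.norm_of_nonneg (by positivity), ← sq_abs]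
    calc |x| ^ 2 * (1 + √T * |x|) ^ M ≤ (1 + |x|) ^ 2 * ((1 + √T) * (1 + |x|)) ^ M := by
          gcongr
          · linarith
          · nlinarith [Real.sqrt_nonneg T, abs_nonneg x]
      _ = _ := by rw [mul_pow, pow_add]; ring
  refine ⟨∫ x, x ^ 2 * (1 + √T * |x|) ^ M ∂g, integral_nonneg fun x => by positivity, ?_⟩
  intro d hd hdT
  have hmap : gaussianReal 0 d.toNNReal = g.map (√d * ·) := by
    rw [hg, gaussianReal_map_const_mul]
    congr 1
    · simp
    · ext; simp [Real.sq_sqrt hd, hd]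
  have hle : ∀ x : ℝ, (√d * x) ^ 2 * (1 + |√d * x|) ^ M ≤ d * (x ^ 2 * (1 + √T * |x|) ^ M) := by
    intro x
    rw [mul_pow, Real.sq_sqrt hd, abs_mul, abs_of_nonneg (Real.sqrt_nonneg d), mul_assoc]
    gcongr
  have hi : Integrable (fun x : ℝ => (√d * x) ^ 2 * (1 + |√d * x|) ^ M) g := by
    refine (hint.const_mul d).mono' (by fun_prop) (Filter.Eventually.of_forall fun x => ?_)
    rw [Real.norm_of_nonneg (by positivity)]
    exact hle x
  rw [hmap]
  constructor
  · rw [integrable_map_measure (by fun_prop) (by fun_prop)]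
    exact hi
  · rw [integral_map (by fun_prop) (by fun_prop)]
    refine (integral_mono hi (hint.const_mul d) hle).trans ?_
    rw [integral_const_mul, mul_comm]

lemma poisson_moment (L : ℝ) (hL : 0 ≤ L) (M : ℕ) : ∃ C : ℝ, 0 ≤ C ∧ ∀ κ : NNReal, (κ : ℝ) ≤ L →
    Integrable (fun v : ℝ => |v| * (1 + |v|) ^ M)
      (Measure.map (fun k : ℕ => (k : ℝ)) (poissonMeasure κ)) ∧
    ∫ v, |v| * (1 + |v|) ^ M ∂(Measure.map (fun k : ℕ => (k : ℝ)) (poissonMeasure κ)) ≤ C * κ := by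
  set b : ℕ → ℝ := fun n => (L + 1) ^ n / n.factorial * (n * (1 + n) ^ M) with hb
  have hb0 : ∀ n, 0 ≤ b n := fun n => by positivity
  have hbs : Summable b := by
    refine Summable.of_nonneg_of_le hb0 (fun n => ?_)
      ((Real.summable_pow_div_factorial ((L + 1) * Real.exp 1)).mul_left
        ((M + 1).factorial * Real.exp 1))
    have h1 : ((1:ℝ) + n) ^ (M + 1) ≤ (M + 1).factorial * (Real.exp 1 * Real.exp 1 ^ n) := by
      have := Real.pow_div_factorial_le_exp (1 + (n:ℝ)) (by positivity) (M + 1)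
      rw [div_le_iff₀ (by positivity), Real.exp_add] at this
      rw [← Real.exp_nat_mul, mul_one]; linarith
    calc b n ≤ (L + 1) ^ n / n.factorial * ((1 + n) ^ (M + 1)) := by
          rw [hb]; simp only
          rw [pow_succ' (1 + (n:ℝ)) M]
          gcongr; linarith
      _ ≤ (L + 1) ^ n / n.factorial * ((M + 1).factorial * (Real.exp 1 * Real.exp 1 ^ n)) := by
          gcongr
      _ = _ := by rw [mul_pow]; ring
  refine ⟨∑' n, b n, tsum_nonneg hb0, fun κ hκ => ?_⟩
  have hterm : ∀ n : ℕ, Real.exp (-κ) * κ ^ n / n.factorial * (|(n:ℝ)| * (1 + |(n:ℝ)|) ^ M)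
      ≤ κ * b n := by
    intro n
    rcases n with _ | n
    · simp [hb]
    · rw [abs_of_nonneg (Nat.cast_nonneg _), hb]
      simp only
      have e1 : Real.exp (-(κ:ℝ)) ≤ 1 := Real.exp_le_one_iff.mpr (by simp)
      have e2 : (κ:ℝ) ^ (n + 1) ≤ κ * (L + 1) ^ (n + 1) := by
        rw [pow_succ']
        gcongr
        calc (κ:ℝ) ^ n ≤ (L + 1) ^ n := by gcongr; linarith
          _ ≤ _ := pow_le_pow_right₀ (by linarith) (by omega)
      calc _ ≤ 1 * (κ * (L + 1) ^ (n + 1)) / (n + 1).factorial *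
            (((n + 1 : ℕ):ℝ) * (1 + ((n + 1 : ℕ):ℝ)) ^ M) := by gcongr
        _ = _ := by ring
  have hi : Integrable (fun k : ℕ => |(k:ℝ)| * (1 + |(k:ℝ)|) ^ M) (poissonMeasure κ) := by
    rw [integrable_poissonMeasure_iff]
    refine Summable.of_nonneg_of_le (fun n => by positivity) (fun n => ?_) (hbs.mul_left (κ:ℝ))
    rw [Real.norm_of_nonneg (by positivity)]
    exact hterm n
  constructor
  · rw [integrable_map_measure (by fun_prop) (by fun_prop)]
    exact hi
  · rw [integral_map (by fun_prop) (by fun_prop)]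
    have hs := hasSum_integral_poissonMeasure hi
    rw [mul_comm]
    exact hasSum_le hterm hs (hbs.hasSum.mul_left _)

/-- The facts on the driving noise that are used. -/
structure Drv {Ω : Type*} {m0 : MeasurableSpace Ω}
    (F : Filtration ℝ m0) (P : Measure Ω) (T : ℝ) (W N : ℝ → Ω → ℝ) : Prop where
  T_pos : 0 < T
  W0 : ∀ ω, W 0 ω = 0
  N0 : ∀ ω, N 0 ω = 0
  adW : ∀ t ∈ Set.Icc (0:ℝ) T, Measurable[F t] (W t)
  adN : ∀ t ∈ Set.Icc (0:ℝ) T, Measurable[F t] (N t)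
  intW : ∀ s t : ℝ, 0 ≤ s → s ≤ t → t ≤ T →
    Integrable (fun ω => W t ω - W s ω) P ∧ ∫ ω, (W t ω - W s ω) ∂P = 0
  mom : ∀ M : ℕ, ∃ C : ℝ, 0 ≤ C ∧ ∀ s t : ℝ, 0 ≤ s → s ≤ t → t ≤ T →
    Integrable (fun ω => hh M (W t ω - W s ω) (N t ω - N s ω)) P ∧
    ∫ ω, hh M (W t ω - W s ω) (N t ω - N s ω) ∂P ≤ C * (t - s)
  indep : ∀ s t : ℝ, 0 ≤ s → s ≤ t → t ≤ T →
      Indep (MeasurableSpace.comap (fun ω => (W t ω - W s ω, N t ω - N s ω)) inferInstance)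
        (F s) P

lemma drv_of {Ω : Type*} {m0 : MeasurableSpace Ω}
    (F : Filtration ℝ m0) (P : Measure Ω) [IsProbabilityMeasure P]
    (T : ℝ) (hT : 0 < T)
    (lam : ℝ → ℝ)
    (hlam_pos : ∀ t ∈ Set.Icc (0:ℝ) T, 0 < lam t)
    (lamB : ℝ) (hlamB : ∀ t ∈ Set.Icc (0:ℝ) T, lam t ≤ lamB)
    (W N : ℝ → Ω → ℝ)
    (hW0 : ∀ ω, W 0 ω = 0) (hN0 : ∀ ω, N 0 ω = 0)
    (hW_adapted : ∀ t ∈ Set.Icc (0:ℝ) T, Measurable[F t] (W t))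
    (hN_adapted : ∀ t ∈ Set.Icc (0:ℝ) T, Measurable[F t] (N t))
    (hW_gauss : ∀ s t : ℝ, 0 ≤ s → s ≤ t → t ≤ T →
      Measure.map (fun ω => W t ω - W s ω) P = gaussianReal 0 (Real.toNNReal (t - s)))
    (hN_poisson : ∀ s t : ℝ, 0 ≤ s → s ≤ t → t ≤ T →
      Measure.map (fun ω => N t ω - N s ω) P
        = Measure.map (fun k : ℕ => (k : ℝ))
            (poissonMeasure (Real.toNNReal (∫ u in s..t, lam u))))
    (h_indep : ∀ s t : ℝ, 0 ≤ s → s ≤ t → t ≤ T →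
      Indep (MeasurableSpace.comap (fun ω => (W t ω - W s ω, N t ω - N s ω)) inferInstance)
        (F s) P) : Drv F P T W N := by
  have mW : ∀ t, 0 ≤ t → t ≤ T → Measurable (W t) := fun t h0 h1 =>
    (hW_adapted t ⟨h0, h1⟩).mono (F.le t) le_rfl
  have mN : ∀ t, 0 ≤ t → t ≤ T → Measurable (N t) := fun t h0 h1 =>
    (hN_adapted t ⟨h0, h1⟩).mono (F.le t) le_rfl
  have hB0 : 0 ≤ lamB := ((hlam_pos 0 ⟨le_rfl, hT.le⟩).le).trans (hlamB 0 ⟨le_rfl, hT.le⟩)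
  refine ⟨hT, hW0, hN0, hW_adapted, hN_adapted, ?_, ?_, h_indep⟩
  · intro s t hs hst ht
    have hm : Measurable (fun ω => W t ω - W s ω) :=
      (mW t (hs.trans hst) ht).sub (mW s hs (hst.trans ht))
    have hi : Integrable (fun x : ℝ => x) (gaussianReal 0 (Real.toNNReal (t - s))) :=
      memLp_one_iff_integrable.mp (memLp_id_gaussianReal 1)
    rw [← hW_gauss s t hs hst ht] at hi
    constructor
    · exact (integrable_map_measure (by fun_prop) hm.aemeasurable).mp hi
    · have := integral_map (μ := P) hm.aemeasurable (f := fun x : ℝ => x) (by fun_prop)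
      rw [← this, hW_gauss s t hs hst ht, integral_id_gaussianReal]
  · intro M
    obtain ⟨C1, hC1, h1⟩ := gauss_moment T hT.le M
    obtain ⟨C2, hC2, h2⟩ := poisson_moment (lamB * T) (by positivity) M
    refine ⟨C1 + C2 * lamB, by positivity, fun s t hs hst ht => ?_⟩
    have hmW : Measurable (fun ω => W t ω - W s ω) :=
      (mW t (hs.trans hst) ht).sub (mW s hs (hst.trans ht))
    have hmN : Measurable (fun ω => N t ω - N s ω) :=
      (mN t (hs.trans hst) ht).sub (mN s hs (hst.trans ht))
    have hk : ((Real.toNNReal (∫ u in s..t, lam u) : NNReal) : ℝ) ≤ lamB * (t - s) := by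
      have := intervalIntegral.norm_integral_le_of_norm_le_const (a := s) (b := t) (f := lam)
        (C := lamB) (by
          intro x hx
          rw [Set.uIoc_of_le hst] at hx
          have hx' : x ∈ Set.Icc (0:ℝ) T := ⟨hs.trans hx.1.le, hx.2.trans ht⟩
          rw [Real.norm_of_nonneg (hlam_pos x hx').le]
          exact hlamB x hx')
      rw [abs_of_nonneg (sub_nonneg.mpr hst)] at this
      rw [Real.coe_toNNReal']
      exact max_le ((Real.le_norm_self _).trans this) (mul_nonneg hB0 (sub_nonneg.mpr hst))
    obtain ⟨i1, j1⟩ := h1 (t - s) (by linarith) (by linarith)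
    obtain ⟨i2, j2⟩ := h2 _ (hk.trans (by gcongr; linarith))
    rw [← hW_gauss s t hs hst ht] at i1 j1
    rw [← hN_poisson s t hs hst ht] at i2 j2
    rw [integral_map hmW.aemeasurable (by fun_prop)] at j1
    rw [integral_map hmN.aemeasurable (by fun_prop)] at j2
    rw [integrable_map_measure (by fun_prop) hmW.aemeasurable] at i1
    rw [integrable_map_measure (by fun_prop) hmN.aemeasurable] at i2
    refine ⟨i1.add i2, ?_⟩
    unfold hh
    refine (integral_add i1 i2).trans_le ?_
    have : C2 * ((Real.toNNReal (∫ u in s..t, lam u) : NNReal) : ℝ) ≤ C2 * (lamB * (t - s)) := by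
      gcongr
    have j2' := j2.trans this
    refine (add_le_add j1 j2').trans_eq (by ring)

lemma step_exp {Ω : Type*} (G : MeasurableSpace Ω) {m0 : MeasurableSpace Ω} (P : Measure Ω)
    [IsProbabilityMeasure P] (hG : G ≤ m0) (w v : Ω → ℝ) (hw : Measurable w) (hv : Measurable v)
    (hind : Indep (MeasurableSpace.comap (fun ω => (w ω, v ω)) inferInstance) G P)
    (Z c : Ω → ℝ) (hZ : Measurable[G] Z) (hc : Measurable[G] c) (hZi : Integrable Z P)
    (B : ℝ) (hB : ∀ ω, |c ω| ≤ B)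
    (hwi : Integrable w P) (hw0 : ∫ ω, w ω ∂P = 0) (M : ℕ)
    (hH : Integrable (fun ω => hh M (w ω) (v ω)) P) (C d : ℝ) :
    Integrable (fun ω => Z ω * (1 + c ω * w ω + C * (d + hh M (w ω) (v ω)))) P ∧
    ∫ ω, Z ω * (1 + c ω * w ω + C * (d + hh M (w ω) (v ω))) ∂P
      = (∫ ω, Z ω ∂P) * (1 + C * (d + ∫ ω, hh M (w ω) (v ω) ∂P)) := by
  have hpair : Measurable (fun ω => (w ω, v ω)) := hw.prodMk hv
  have ind1 : ∀ (f : Ω → ℝ) (g : ℝ × ℝ → ℝ), Measurable[G] f → Measurable g →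
      IndepFun f (fun ω => g (w ω, v ω)) P := by
    intro f g hf hg
    rw [IndepFun_iff_Indep]
    refine indep_of_indep_of_le_left (indep_of_indep_of_le_right hind.symm ?_) ?_
    · rintro _ ⟨A, hA, rfl⟩
      exact ⟨g ⁻¹' A, hg hA, rfl⟩
    · exact hf.comap_le
  have hZc : Measurable[G] (fun ω => Z ω * c ω) := hZ.mul hc
  have i1 : IndepFun (fun ω => Z ω * c ω) w P := ind1 _ Prod.fst hZc measurable_fst
  have i2 : IndepFun Z (fun ω => hh M (w ω) (v ω)) P :=
    ind1 _ (fun q => hh M q.1 q.2) hZ (by unfold hh; fun_prop)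
  have hZci : Integrable (fun ω => Z ω * c ω) P := by
    refine (hZi.norm.const_mul B).mono' (hZc.mono hG le_rfl).aestronglyMeasurable
      (Filter.Eventually.of_forall fun ω => ?_)
    rw [norm_mul, mul_comm]
    gcongr
    exact hB ω
  have k1 : Integrable (fun ω => Z ω * c ω * w ω) P := i1.integrable_mul hZci hwi
  have k2 : Integrable (fun ω => Z ω * hh M (w ω) (v ω)) P := i2.integrable_mul hZi hH
  have e : (fun ω => Z ω * (1 + c ω * w ω + C * (d + hh M (w ω) (v ω))))
      = fun ω => ((1 + C * d) * Z ω + Z ω * c ω * w ω) + C * (Z ω * hh M (w ω) (v ω)) := by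
    funext ω; ring
  have l1 : Integrable (fun ω => (1 + C * d) * Z ω) P := hZi.const_mul _
  have l2 : Integrable (fun ω => (1 + C * d) * Z ω + Z ω * c ω * w ω) P := l1.add k1
  have l3 : Integrable (fun ω => C * (Z ω * hh M (w ω) (v ω))) P := k2.const_mul _
  rw [e]
  refine ⟨l2.add l3, ?_⟩
  rw [integral_add l2 l3, integral_add l1 k1, integral_const_mul, integral_const_mul,
    i1.integral_fun_mul_eq_mul_integral hZci.aestronglyMeasurable hwi.aestronglyMeasurable,
    i2.integral_fun_mul_eq_mul_integral hZi.aestronglyMeasurable hH.aestronglyMeasurable, hw0]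
  ring

section grid

variable {Ω : Type*} {m0 : MeasurableSpace Ω}

lemma grid_le {T : ℝ} (hT : 0 < T) {n j : ℕ} (hn : 0 < n) (hj : j ≤ n) :
    0 ≤ (j:ℝ) * (T / n) ∧ (j:ℝ) * (T / n) ≤ T := by
  have hn' : (0:ℝ) < n := by exact_mod_cast hn
  have hj' : (j:ℝ) ≤ n := by exact_mod_cast hj
  refine ⟨by positivity, ?_⟩
  rw [mul_div_assoc', div_le_iff₀ hn']
  nlinarith

lemma grid_meas {F : Filtration ℝ m0} {P : Measure Ω} {T : ℝ} {W N : ℝ → Ω → ℝ}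
    (D : Drv F P T W N) (μ σ ρ : ℝ → ℝ) (hμ : Measurable μ) (hσ : Measurable σ)
    (hρ : Measurable ρ) (ξ : ℝ) (n : ℕ) (hn : 0 < n) (j : ℕ) (hj : j ≤ n) :
    Measurable[F ((j:ℝ) * (T / n))] (emGrid μ σ ρ W N (T / n) ξ j) := by
  induction j with
  | zero => exact measurable_const
  | succ j ih =>
    have h0 := grid_le D.T_pos hn (show j ≤ n by omega)
    have h1 := grid_le D.T_pos hn hj
    have hle : (j:ℝ) * (T / n) ≤ ((j + 1 : ℕ):ℝ) * (T / n) := by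
      have := D.T_pos
      gcongr; omega
    have hX := (ih (by omega)).mono (F.mono hle) le_rfl
    have hWs := (D.adW _ h0).mono (F.mono hle) le_rfl
    have hWt := D.adW _ h1
    have hNs := (D.adN _ h0).mono (F.mono hle) le_rfl
    have hNt := D.adN _ h1
    have hfun : emGrid μ σ ρ W N (T / n) ξ (j + 1) = fun ω =>
        emGrid μ σ ρ W N (T / n) ξ j ω
        + μ (emGrid μ σ ρ W N (T / n) ξ j ω) * (T / n)
        + σ (emGrid μ σ ρ W N (T / n) ξ j ω)
          * (W (((j + 1 : ℕ) : ℝ) * (T / n)) ω - W ((j : ℝ) * (T / n)) ω)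
        + ρ (emGrid μ σ ρ W N (T / n) ξ j ω)
          * (N (((j + 1 : ℕ) : ℝ) * (T / n)) ω - N ((j : ℝ) * (T / n)) ω) := by
      funext ω; rw [emGrid]; push_cast; rfl
    rw [hfun]
    exact ((hX.add ((hμ.comp hX).mul_const _)).add ((hσ.comp hX).mul (hWt.sub hWs))).add
      ((hρ.comp hX).mul (hNt.sub hNs))

lemma grid_step {F : Filtration ℝ m0} {P : Measure Ω} [IsProbabilityMeasure P] {T : ℝ}
    {W N : ℝ → Ω → ℝ}
    (D : Drv F P T W N) (μ σ ρ : ℝ → ℝ) (hμ : Measurable μ) (hσ : Measurable σ)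
    (hρ : Measurable ρ) (K : ℝ) (hK : 1 ≤ K) (gμ : ∀ x, |μ x| ≤ K * (1 + |x|))
    (gσ : ∀ x, |σ x| ≤ K * (1 + |x|)) (gρ : ∀ x, |ρ x| ≤ K * (1 + |x|)) (ξ : ℝ) (r : ℕ) :
    ∃ C : ℝ, 0 ≤ C ∧ ∀ n : ℕ, 0 < n → ∀ j, j < n → ∀ Z : Ω → ℝ,
      Measurable[F ((j:ℝ) * (T / n))] Z → (∀ ω, 0 ≤ Z ω) →
      Integrable (fun ω => Z ω * (1 + (emGrid μ σ ρ W N (T / n) ξ j ω) ^ 2) ^ r) P →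
      Integrable (fun ω => Z ω * (1 + (emGrid μ σ ρ W N (T / n) ξ (j + 1) ω) ^ 2) ^ r) P ∧
      ∫ ω, Z ω * (1 + (emGrid μ σ ρ W N (T / n) ξ (j + 1) ω) ^ 2) ^ r ∂P
        ≤ (1 + C * (T / n)) * ∫ ω, Z ω * (1 + (emGrid μ σ ρ W N (T / n) ξ j ω) ^ 2) ^ r ∂P ∧
      (1 - C * (T / n)) * ∫ ω, Z ω * (1 + (emGrid μ σ ρ W N (T / n) ξ j ω) ^ 2) ^ r ∂P
        ≤ ∫ ω, Z ω * (1 + (emGrid μ σ ρ W N (T / n) ξ (j + 1) ω) ^ 2) ^ r ∂P := by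
  have hT := D.T_pos
  obtain ⟨C1, hC1, h1⟩ := one_step K T hK hT.le r
  obtain ⟨C2, hC2, h2⟩ := D.mom (2 * r + 3)
  refine ⟨C1 * (1 + C2), by positivity, ?_⟩
  intro n hn j hj Z hZ hZ0 hZi
  have hn' : (0:ℝ) < n := by exact_mod_cast hn
  have hd0 : 0 ≤ T / n := by positivity
  have hdT : T / n ≤ T := div_le_self hT.le (by exact_mod_cast hn)
  have b0 := grid_le hT hn hj.le
  have b1 := grid_le hT hn (show j + 1 ≤ n from hj)
  have hle : (j:ℝ) * (T / n) ≤ ((j + 1 : ℕ):ℝ) * (T / n) := by gcongr; omega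
  have hts : ((j + 1 : ℕ):ℝ) * (T / n) - (j:ℝ) * (T / n) = T / n := by push_cast; ring
  obtain ⟨hHi, hHb⟩ := h2 _ _ b0.1 hle b1.2
  obtain ⟨hwi, hw0⟩ := D.intW _ _ b0.1 hle b1.2
  have hind := D.indep _ _ b0.1 hle b1.2
  rw [hts] at hHb
  have hXm := grid_meas D μ σ ρ hμ hσ hρ ξ n hn j hj.le
  have hXm1 := (grid_meas D μ σ ρ hμ hσ hρ ξ n hn (j + 1) hj).mono (F.le _) le_rfl
  set d := T / n with hd
  set w : Ω → ℝ := fun ω => W (((j + 1 : ℕ):ℝ) * d) ω - W ((j:ℝ) * d) ω with hw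
  set v : Ω → ℝ := fun ω => N (((j + 1 : ℕ):ℝ) * d) ω - N ((j:ℝ) * d) ω with hv
  set X := emGrid μ σ ρ W N d ξ j with hX
  have hX1 : ∀ ω, emGrid μ σ ρ W N d ξ (j + 1) ω
      = X ω + μ (X ω) * d + σ (X ω) * w ω + ρ (X ω) * v ω := by
    intro ω; rw [emGrid, hX, hw, hv]; push_cast; rfl
  have hwm : Measurable w := ((D.adW _ b1).mono (F.le _) le_rfl).sub
    ((D.adW _ b0).mono (F.le _) le_rfl)
  have hvm : Measurable v := ((D.adN _ b1).mono (F.le _) le_rfl).sub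
    ((D.adN _ b0).mono (F.le _) le_rfl)
  set c : Ω → ℝ := fun ω => r * (2 * X ω * σ (X ω) / (1 + X ω ^ 2)) with hc
  have hcm : Measurable[F ((j:ℝ) * d)] c := by
    have : Measurable (fun x : ℝ => r * (2 * x * σ x / (1 + x ^ 2))) := by fun_prop
    exact this.comp hXm
  have hcb : ∀ ω, |c ω| ≤ r * (4 * K) := by
    intro ω
    obtain ⟨-, e2, -⟩ := u_bounds K (X ω) (μ (X ω)) (σ (X ω)) (ρ (X ω)) d 1 0 hK hd0
      (gμ _) (gσ _) (gρ _)
    rw [hc]; simp only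
    rw [abs_mul, Nat.abs_cast]
    gcongr
    simpa [mul_assoc] using e2
  have hpm : Measurable (fun x : ℝ => (1 + x ^ 2) ^ r) := by fun_prop
  have hZφ : Measurable[F ((j:ℝ) * d)] (fun ω => Z ω * (1 + X ω ^ 2) ^ r) :=
    hZ.mul (hpm.comp hXm)
  have hZφ0 : 0 ≤ ∫ ω, Z ω * (1 + X ω ^ 2) ^ r ∂P :=
    integral_nonneg fun ω => mul_nonneg (hZ0 ω) (by positivity)
  have S := step_exp (F ((j:ℝ) * d)) P (F.le _) w v hwm hvm hind
    (fun ω => Z ω * (1 + X ω ^ 2) ^ r) c hZφ hcm hZi _ hcb hwi hw0 (2 * r + 3) hHi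
  obtain ⟨u1, u2⟩ := S C1 d
  obtain ⟨l1, l2⟩ := S (-C1) d
  have up : ∀ ω, Z ω * (1 + (emGrid μ σ ρ W N d ξ (j + 1) ω) ^ 2) ^ r ≤
      Z ω * (1 + X ω ^ 2) ^ r * (1 + c ω * w ω + C1 * (d + hh (2 * r + 3) (w ω) (v ω))) := by
    intro ω
    rw [hX1, mul_assoc]
    exact mul_le_mul_of_nonneg_left (h1 _ _ _ _ _ _ _ hd0 hdT (gμ _) (gσ _) (gρ _)).1 (hZ0 ω)
  have lo : ∀ ω, Z ω * (1 + X ω ^ 2) ^ r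
        * (1 + c ω * w ω + (-C1) * (d + hh (2 * r + 3) (w ω) (v ω))) ≤
      Z ω * (1 + (emGrid μ σ ρ W N d ξ (j + 1) ω) ^ 2) ^ r := by
    intro ω
    rw [hX1, mul_assoc]
    exact mul_le_mul_of_nonneg_left (h1 _ _ _ _ _ _ _ hd0 hdT (gμ _) (gσ _) (gρ _)).2 (hZ0 ω)
  have hI : Integrable (fun ω => Z ω * (1 + (emGrid μ σ ρ W N d ξ (j + 1) ω) ^ 2) ^ r) P := by
    refine u1.mono' ?_ (Filter.Eventually.of_forall fun ω => ?_)
    · exact ((hZ.mono (F.le _) le_rfl).mul (hpm.comp hXm1)).aestronglyMeasurable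
    · rw [Real.norm_of_nonneg (mul_nonneg (hZ0 ω) (by positivity))]
      exact up ω
  have hEH : C1 * (d + ∫ ω, hh (2 * r + 3) (w ω) (v ω) ∂P) ≤ C1 * (1 + C2) * d := by
    have := mul_le_mul_of_nonneg_left (add_le_add_right hHb d) hC1
    linarith
  refine ⟨hI, ?_, ?_⟩
  · refine (integral_mono hI u1 up).trans ?_
    rw [u2, mul_comm]
    refine mul_le_mul_of_nonneg_right ?_ hZφ0
    linarith
  · refine le_trans ?_ (integral_mono l1 hI lo)
    rw [l2, mul_comm]
    refine mul_le_mul_of_nonneg_left ?_ hZφ0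
    linarith

end grid

/-- Running maximum of a sequence. -/
noncomputable def runMax (Y : ℕ → ℝ) : ℕ → ℝ
  | 0 => Y 0
  | (j + 1) => max (runMax Y j) (Y (j + 1))

lemma le_runMax (Y : ℕ → ℝ) {i j : ℕ} (h : i ≤ j) : Y i ≤ runMax Y j := by
  induction j with
  | zero => obtain rfl : i = 0 := by omega
            exact le_rfl
  | succ j ih =>
    rcases Nat.lt_or_ge i (j + 1) with h' | h'
    · exact (ih (by omega)).trans (le_max_left _ _)
    · obtain rfl : i = j + 1 := by omega
      exact le_max_right _ _

lemma runMax_mono (Y : ℕ → ℝ) {i j : ℕ} (h : i ≤ j) : runMax Y i ≤ runMax Y j := by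
  induction j with
  | zero => obtain rfl : i = 0 := by omega
            exact le_rfl
  | succ j ih =>
    rcases Nat.lt_or_ge i (j + 1) with h' | h'
    · exact (ih (by omega)).trans (le_max_left _ _)
    · obtain rfl : i = j + 1 := by omega
      exact le_rfl

lemma runMax_step (Y : ℕ → ℝ) (j : ℕ) :
    2 * runMax Y j * Y j - runMax Y j ^ 2 + 2 * (runMax Y j * Y (j + 1) - runMax Y j * Y j)
      ≤ 2 * runMax Y (j + 1) * Y (j + 1) - runMax Y (j + 1) ^ 2 := by
  rw [runMax]
  rcases le_total (runMax Y j) (Y (j + 1)) with h | h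
  · rw [max_eq_right h]; nlinarith [sq_nonneg (Y (j + 1) - runMax Y j)]
  · rw [max_eq_left h]; nlinarith

section grid

variable {Ω : Type*} {m0 : MeasurableSpace Ω}

lemma grid_mom {F : Filtration ℝ m0} {P : Measure Ω} [IsProbabilityMeasure P] {T : ℝ}
    {W N : ℝ → Ω → ℝ}
    (D : Drv F P T W N) (μ σ ρ : ℝ → ℝ) (hμ : Measurable μ) (hσ : Measurable σ)
    (hρ : Measurable ρ) (K : ℝ) (hK : 1 ≤ K) (gμ : ∀ x, |μ x| ≤ K * (1 + |x|))
    (gσ : ∀ x, |σ x| ≤ K * (1 + |x|)) (gρ : ∀ x, |ρ x| ≤ K * (1 + |x|)) (ξ : ℝ) (r : ℕ) :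
    ∃ A : ℝ, 0 ≤ A ∧ ∀ n : ℕ, 0 < n → ∀ j, j ≤ n →
      Integrable (fun ω => (1 + (emGrid μ σ ρ W N (T / n) ξ j ω) ^ 2) ^ r) P ∧
      ∫ ω, (1 + (emGrid μ σ ρ W N (T / n) ξ j ω) ^ 2) ^ r ∂P ≤ A := by
  have hT := D.T_pos
  obtain ⟨C, hC, h⟩ := grid_step D μ σ ρ hμ hσ hρ K hK gμ gσ gρ ξ r
  refine ⟨Real.exp (C * T) * (1 + ξ ^ 2) ^ r, by positivity, fun n hn => ?_⟩
  have hn' : (0:ℝ) < n := by exact_mod_cast hn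
  have hd0 : 0 ≤ T / n := by positivity
  have main : ∀ j, j ≤ n → Integrable (fun ω => (1 + (emGrid μ σ ρ W N (T / n) ξ j ω) ^ 2) ^ r) P ∧
      ∫ ω, (1 + (emGrid μ σ ρ W N (T / n) ξ j ω) ^ 2) ^ r ∂P
        ≤ (1 + C * (T / n)) ^ j * (1 + ξ ^ 2) ^ r := by
    intro j
    induction j with
    | zero => intro _; simp [emGrid]
    | succ j ih =>
      intro hj
      obtain ⟨i1, i2⟩ := ih (by omega)
      obtain ⟨k1, k2, -⟩ := h n hn j hj (fun _ => 1) measurable_const (fun _ => zero_le_one)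
        (by simpa using i1)
      simp only [one_mul] at k1 k2
      refine ⟨k1, k2.trans ?_⟩
      rw [pow_succ', mul_assoc]
      gcongr
  intro j hj
  refine ⟨(main j hj).1, (main j hj).2.trans ?_⟩
  gcongr
  calc (1 + C * (T / n)) ^ j ≤ (Real.exp (C * (T / n))) ^ j := by
        gcongr
        linarith [Real.add_one_le_exp (C * (T / n))]
    _ = Real.exp (C * (j * (T / n))) := by rw [← Real.exp_nat_mul]; congr 1; ring
    _ ≤ Real.exp (C * T) := by
        gcongr
        exact (grid_le hT hn hj).2

lemma grid_max {F : Filtration ℝ m0} {P : Measure Ω} [IsProbabilityMeasure P] {T : ℝ}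
    {W N : ℝ → Ω → ℝ}
    (D : Drv F P T W N) (μ σ ρ : ℝ → ℝ) (hμ : Measurable μ) (hσ : Measurable σ)
    (hρ : Measurable ρ) (K : ℝ) (hK : 1 ≤ K) (gμ : ∀ x, |μ x| ≤ K * (1 + |x|))
    (gσ : ∀ x, |σ x| ≤ K * (1 + |x|)) (gρ : ∀ x, |ρ x| ≤ K * (1 + |x|)) (ξ : ℝ) (k : ℕ) :
    ∃ C : ℝ, 0 ≤ C ∧ ∀ n : ℕ, 0 < n → ∃ G : Ω → ENNReal, Measurable G ∧
      (∀ j ≤ n, ∀ ω, ENNReal.ofReal (((1 + (emGrid μ σ ρ W N (T / n) ξ j ω) ^ 2) ^ k) ^ 2) ≤ G ω) ∧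
      ∫⁻ ω, G ω ∂P ≤ ENNReal.ofReal C := by
  have hT := D.T_pos
  obtain ⟨C, hC, h⟩ := grid_step D μ σ ρ hμ hσ hρ K hK gμ gσ gρ ξ k
  obtain ⟨A, hA, hmom⟩ := grid_mom D μ σ ρ hμ hσ hρ K hK gμ gσ gρ ξ (k * 2)
  set c := C * T with hc
  have hc0 : 0 ≤ c := by positivity
  refine ⟨4 * (2 * A + 4 * c * (c + 1) * A), by positivity, fun n hn => ?_⟩
  have hn' : (0:ℝ) < n := by exact_mod_cast hn
  set d := T / n with hd
  have hd0 : 0 ≤ d := by positivity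
  set Y : Ω → ℕ → ℝ := fun ω j => (1 + (emGrid μ σ ρ W N d ξ j ω) ^ 2) ^ k with hY
  have hY0 : ∀ ω j, 0 ≤ Y ω j := fun ω j => by positivity
  have hS0 : ∀ ω j, 0 ≤ runMax (Y ω) j := fun ω j => (hY0 ω j).trans (le_runMax _ le_rfl)
  have hYS : ∀ ω j, Y ω j ≤ runMax (Y ω) j := fun ω j => le_runMax _ le_rfl
  have hYm : ∀ j ≤ n, Measurable[F ((j:ℝ) * d)] (fun ω => Y ω j) := fun j hj => by
    have hpm : Measurable (fun x : ℝ => (1 + x ^ 2) ^ k) := by fun_prop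
    exact hpm.comp (grid_meas D μ σ ρ hμ hσ hρ ξ n hn j hj)
  have hSm : ∀ j ≤ n, Measurable[F ((j:ℝ) * d)] (fun ω => runMax (Y ω) j) := by
    intro j
    induction j with
    | zero => intro hj; exact hYm 0 hj
    | succ j ih =>
      intro hj
      have hle : (j:ℝ) * d ≤ ((j + 1 : ℕ):ℝ) * d := by gcongr; omega
      exact ((ih (by omega)).mono (F.mono hle) le_rfl).max (hYm _ hj)
  have hYi : ∀ j ≤ n, Integrable (fun ω => Y ω j ^ 2) P := fun j hj => by
    have := (hmom n hn j hj).1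
    simpa only [pow_mul] using this
  have hYb : ∀ j ≤ n, ∫ ω, Y ω j ^ 2 ∂P ≤ A := fun j hj => by
    have := (hmom n hn j hj).2
    simpa only [pow_mul] using this
  have hSm' : ∀ j ≤ n, Measurable (fun ω => runMax (Y ω) j) := fun j hj =>
    (hSm j hj).mono (F.le _) le_rfl
  have hYm' : ∀ j ≤ n, Measurable (fun ω => Y ω j) := fun j hj =>
    (hYm j hj).mono (F.le _) le_rfl
  have hSi : ∀ j ≤ n, Integrable (fun ω => runMax (Y ω) j ^ 2) P := by
    intro j
    induction j with
    | zero => intro hj; exact hYi 0 hj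
    | succ j ih =>
      intro hj
      refine ((ih (by omega)).add (hYi _ hj)).mono' ((hSm' _ hj).pow_const 2).aestronglyMeasurable
        (Filter.Eventually.of_forall fun ω => ?_)
      rw [Real.norm_of_nonneg (by positivity), runMax]
      simp only [Pi.add_apply]
      rcases max_choice (runMax (Y ω) j) (Y ω (j + 1)) with e | e <;> rw [e] <;>
        nlinarith [sq_nonneg (runMax (Y ω) j), sq_nonneg (Y ω (j + 1))]
  have hSYi : ∀ j ≤ n, Integrable (fun ω => runMax (Y ω) j * Y ω j) P := by
    intro j hj
    refine (hSi j hj).mono' ((hSm' _ hj).mul (hYm' _ hj)).aestronglyMeasurable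
      (Filter.Eventually.of_forall fun ω => ?_)
    rw [Real.norm_of_nonneg (mul_nonneg (hS0 _ _) (hY0 _ _)), sq]
    exact mul_le_mul_of_nonneg_left (hYS ω j) (hS0 _ _)
  set E := ∫ ω, runMax (Y ω) n ^ 2 ∂P with hE
  have hE0 : 0 ≤ E := integral_nonneg fun ω => by positivity
  set B := E / (8 * (c + 1)) + 2 * (c + 1) * A with hB
  have hSYb : ∀ j ≤ n, ∫ ω, runMax (Y ω) j * Y ω j ∂P ≤ B := by
    intro j hj
    have hi := ((hSi n le_rfl).div_const (8 * (c + 1))).add ((hYi j hj).const_mul (2 * (c + 1)))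
    refine (integral_mono (hSYi j hj) hi (fun ω => ?_)).trans ?_
    · simp only [Pi.add_apply]
      have h1 : runMax (Y ω) j ≤ runMax (Y ω) n := runMax_mono _ hj
      have h2 : runMax (Y ω) j * Y ω j ≤ runMax (Y ω) n * Y ω j :=
        mul_le_mul_of_nonneg_right h1 (hY0 _ _)
      refine h2.trans ?_
      generalize runMax (Y ω) n = S
      generalize Y ω j = y
      have hc1 : 0 < c + 1 := by positivity
      rw [← sub_nonneg]
      have : S ^ 2 / (8 * (c + 1)) + 2 * (c + 1) * y ^ 2 - S * y
          = (S - 4 * (c + 1) * y) ^ 2 / (8 * (c + 1)) := by field_simp; ring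
      rw [this]; positivity
    · refine (integral_add ((hSi n le_rfl).div_const _) ((hYi j hj).const_mul _)).trans_le ?_
      rw [integral_div, integral_const_mul, hB]
      have := hYb j hj
      gcongr
  have hVi : ∀ j ≤ n, Integrable (fun ω => 2 * runMax (Y ω) j * Y ω j - runMax (Y ω) j ^ 2) P := by
    intro j hj
    have := ((hSYi j hj).const_mul 2).sub (hSi j hj)
    refine this.congr (Filter.Eventually.of_forall fun ω => ?_)
    simp only [Pi.sub_apply]; ring
  have hV : ∀ j ≤ n, -(2 * C * d * j * B)
      ≤ ∫ ω, (2 * runMax (Y ω) j * Y ω j - runMax (Y ω) j ^ 2) ∂P := by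
    intro j
    induction j with
    | zero =>
      intro _
      simp only [Nat.cast_zero, mul_zero, zero_mul, neg_zero]
      refine integral_nonneg fun ω => ?_
      simp only [runMax, Pi.zero_apply]
      nlinarith [sq_nonneg (Y ω 0)]
    | succ j ih =>
      intro hj
      have hj' : j ≤ n := by omega
      obtain ⟨a1, -, a3⟩ := h n hn j hj (fun ω => runMax (Y ω) j) (hSm j hj') (fun ω => hS0 ω j)
        (hSYi j hj')
      have a1' : Integrable (fun ω => runMax (Y ω) j * Y ω (j + 1)) P := a1
      have a3' : (1 - C * d) * ∫ ω, runMax (Y ω) j * Y ω j ∂P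
        ≤ ∫ ω, runMax (Y ω) j * Y ω (j + 1) ∂P := a3
      have hdi : Integrable (fun ω => runMax (Y ω) j * Y ω (j + 1) - runMax (Y ω) j * Y ω j) P :=
        a1'.sub (hSYi j hj')
      have s1 := integral_mono ((hVi j hj').add (hdi.const_mul 2)) (hVi _ hj)
        (fun ω => runMax_step (Y ω) j)
      have s2 := integral_add (hVi j hj') (hdi.const_mul 2)
      have s3 := s2.symm.trans_le s1
      rw [integral_const_mul, integral_sub a1' (hSYi j hj')] at s3
      have s4 := ih hj'
      have s5 : C * d * ∫ ω, runMax (Y ω) j * Y ω j ∂P ≤ C * d * B :=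
        mul_le_mul_of_nonneg_left (hSYb j hj') (by positivity)
      push_cast
      linarith
  have hfin : E ≤ 4 * (2 * A + 4 * c * (c + 1) * A) := by
    have v1 := hV n le_rfl
    have hi := ((hYi n le_rfl).const_mul 2).sub ((hSi n le_rfl).const_mul (1 / 2))
    have v2 : ∫ ω, (2 * runMax (Y ω) n * Y ω n - runMax (Y ω) n ^ 2) ∂P
        ≤ ∫ ω, (2 * Y ω n ^ 2 - 1 / 2 * runMax (Y ω) n ^ 2) ∂P := by
      refine integral_mono (hVi n le_rfl) hi (fun ω => ?_)
      nlinarith [sq_nonneg (runMax (Y ω) n - 2 * Y ω n)]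
    rw [integral_sub ((hYi n le_rfl).const_mul 2) ((hSi n le_rfl).const_mul (1 / 2)),
      integral_const_mul, integral_const_mul] at v2
    have v3 := hYb n le_rfl
    have e1 : 2 * C * d * n * B = 2 * c * B := by rw [hc, hd]; field_simp
    rw [e1] at v1
    have e2 : 2 * c * B ≤ E / 4 + 4 * c * (c + 1) * A := by
      have : 2 * c * B = (c / (c + 1)) * (E / 4) + 4 * c * (c + 1) * A := by
        rw [hB]; field_simp; ring
      rw [this]
      have : c / (c + 1) ≤ 1 := by rw [div_le_one (by positivity)]; linarith
      nlinarith
    linarith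
  refine ⟨fun ω => ENNReal.ofReal (runMax (Y ω) n ^ 2), ?_, ?_, ?_⟩
  · exact ((hSm' n le_rfl).pow_const 2).ennreal_ofReal
  · intro j hj ω
    refine ENNReal.ofReal_le_ofReal (pow_le_pow_left₀ (hY0 ω j) (le_runMax (Y ω) hj) 2)
  · rw [← ofReal_integral_eq_lintegral_ofReal (hSi n le_rfl)
      (Filter.Eventually.of_forall fun ω => by positivity)]
    exact ENNReal.ofReal_le_ofReal hfin

lemma grid_W {F : Filtration ℝ m0} {P : Measure Ω} {T : ℝ} {W N : ℝ → Ω → ℝ}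
    (D : Drv F P T W N) (d : ℝ) (j : ℕ) (ω : Ω) :
    emGrid (fun _ => 0) (fun _ => 1) (fun _ => 0) W N d 0 j ω = W ((j:ℝ) * d) ω := by
  induction j with
  | zero => simp [emGrid, D.W0]
  | succ j ih => rw [emGrid, ih]; push_cast; ring

lemma grid_N {F : Filtration ℝ m0} {P : Measure Ω} {T : ℝ} {W N : ℝ → Ω → ℝ}
    (D : Drv F P T W N) (d : ℝ) (j : ℕ) (ω : Ω) :
    emGrid (fun _ => 0) (fun _ => 0) (fun _ => 1) W N d 0 j ω = N ((j:ℝ) * d) ω := by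
  induction j with
  | zero => simp [emGrid, D.N0]
  | succ j ih => rw [emGrid, ih]; push_cast; ring

lemma floor_grid {T : ℝ} (hT : 0 < T) {n : ℕ} (hn : 0 < n) {t : ℝ} (ht : t ∈ Set.Icc 0 T) :
    ⌊t / (T / n)⌋.toNat ≤ n ∧ lastGrid (T / n) t ≤ t ∧ t - T / n ≤ lastGrid (T / n) t := by
  have hn' : (0:ℝ) < n := by exact_mod_cast hn
  have hd : 0 < T / n := by positivity
  have h0 : 0 ≤ t / (T / n) := div_nonneg ht.1 hd.le
  rw [Int.floor_toNat]
  unfold lastGrid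
  rw [Int.floor_toNat]
  have h1 : t / (T / n) ≤ n := by
    rw [div_le_iff₀ hd]
    have : (n:ℝ) * (T / n) = T := by field_simp
    rw [this]; exact ht.2
  refine ⟨?_, ?_, ?_⟩
  · exact Nat.floor_le_of_le h1
  · have := Nat.floor_le h0
    rwa [le_div_iff₀ hd] at this
  · have := (Nat.lt_floor_add_one (t / (T / n))).le
    rw [div_le_iff₀ hd] at this
    linarith

lemma sup_W {F : Filtration ℝ m0} {P : Measure Ω} [IsProbabilityMeasure P] {T : ℝ}
    {W N : ℝ → Ω → ℝ} (D : Drv F P T W N)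
    (hW_cont : ∀ᵐ ω ∂P, ContinuousOn (fun t => W t ω) (Set.Icc 0 T)) (k : ℕ) :
    ∃ C : ℝ, 0 ≤ C ∧ ∃ G : Ω → ENNReal, Measurable G ∧
      (∀ᵐ ω ∂P, ∀ t ∈ Set.Icc 0 T, ENNReal.ofReal (((1 + W t ω ^ 2) ^ k) ^ 2) ≤ G ω) ∧
      ∫⁻ ω, G ω ∂P ≤ ENNReal.ofReal C := by
  have hT := D.T_pos
  obtain ⟨C, hC, h⟩ := grid_max D (fun _ => 0) (fun _ => 1) (fun _ => 0) measurable_const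
    measurable_const measurable_const 1 le_rfl (fun x => by simp; positivity) (fun x => by simp)
    (fun x => by simp; positivity) 0 k
  choose G hGm hGb hGi using fun i : ℕ => h (i + 1) i.succ_pos
  refine ⟨C, hC, fun ω => Filter.liminf (fun i => G i ω) Filter.atTop,
    Measurable.liminf hGm, ?_, ?_⟩
  · filter_upwards [hW_cont] with ω hω t ht
    set s : ℕ → ℝ := fun i => lastGrid (T / ((i + 1 : ℕ):ℝ)) t with hs
    have hsT : ∀ i, s i ∈ Set.Icc 0 T := fun i => by
      obtain ⟨-, a, -⟩ := floor_grid hT i.succ_pos ht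
      refine ⟨?_, a.trans ht.2⟩
      rw [hs]; simp only [lastGrid]; positivity
    have hlim : Filter.Tendsto s Filter.atTop (nhds t) := by
      refine tendsto_of_tendsto_of_tendsto_of_le_of_le (g := fun i : ℕ => t - T / ((i + 1 : ℕ):ℝ))
        (h := fun _ => t) ?_ tendsto_const_nhds ?_ ?_
      · have : Filter.Tendsto (fun i : ℕ => T / ((i + 1 : ℕ):ℝ)) Filter.atTop (nhds 0) :=
          (tendsto_const_div_atTop_nhds_zero_nat T).comp (Filter.tendsto_add_atTop_nat 1)
        simpa using this.const_sub t
      · intro i; exact (floor_grid hT i.succ_pos ht).2.2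
      · intro i; exact (floor_grid hT i.succ_pos ht).2.1
    have hWs : Filter.Tendsto (fun i => W (s i) ω) Filter.atTop (nhds (W t ω)) := by
      have := hω t ht
      exact this.tendsto.comp (tendsto_nhdsWithin_iff.mpr ⟨hlim, Filter.Eventually.of_forall hsT⟩)
    have hcont : Continuous (fun x : ℝ => ENNReal.ofReal (((1 + x ^ 2) ^ k) ^ 2)) :=
      ENNReal.continuous_ofReal.comp (by fun_prop)
    have hl := (hcont.tendsto (W t ω)).comp hWs
    rw [← hl.liminf_eq]
    refine Filter.liminf_le_liminf (Filter.Eventually.of_forall fun i => ?_)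
    have := hGb i (⌊t / (T / ((i + 1 : ℕ):ℝ))⌋.toNat) (floor_grid hT i.succ_pos ht).1 ω
    rw [grid_W D] at this
    exact this
  · refine (lintegral_liminf_le hGm).trans ?_
    refine Filter.liminf_le_of_le (by isBoundedDefault) fun b hb => ?_
    obtain ⟨i, hi⟩ := hb.exists
    exact hi.trans (hGi i)

lemma three_pow (k : ℕ) (a b c : ℝ) (ha : 0 ≤ a) (hb : 0 ≤ b) (hc : 0 ≤ c) :
    (a + b + c) ^ k ≤ 3 ^ k * (a ^ k + b ^ k + c ^ k) := by
  have key : ∀ d : ℝ, 0 ≤ d → a ≤ d → b ≤ d → c ≤ d → (a + b + c) ^ k ≤ 3 ^ k * d ^ k := by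
    intro d hd h1 h2 h3
    rw [← mul_pow]
    gcongr; linarith
  have pa : 0 ≤ a ^ k := by positivity
  have pb : 0 ≤ b ^ k := by positivity
  have pc : 0 ≤ c ^ k := by positivity
  rcases le_total a b with h | h <;> rcases le_total b c with h' | h' <;>
    rcases le_total a c with h'' | h''
  all_goals first
    | (refine (key a ha le_rfl (by linarith) (by linarith)).trans ?_
       gcongr; linarith)
    | (refine (key b hb (by linarith) le_rfl (by linarith)).trans ?_
       gcongr; linarith)
    | (refine (key c hc (by linarith) (by linarith) le_rfl).trans ?_
       gcongr; linarith)

lemma final_alg (K T p : ℝ) (hK : 1 ≤ K) (hT : 0 ≤ T) (k : ℕ) (hp : 0 ≤ p) (hpk : p ≤ k) :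
    ∃ C : ℝ, 0 ≤ C ∧ ∀ x y a b c : ℝ, |y| ≤ |x| + K * (1 + |x|) * (T + |a| + |b| + |c|) →
      |y| ^ p ≤ C * (((1 + x ^ 2) ^ k) ^ 2 + (((1 + a ^ 2) ^ k) ^ 2
        + (((1 + b ^ 2) ^ k) ^ 2 + ((1 + c ^ 2) ^ k) ^ 2))) := by
  set C1 : ℝ := (K ^ 2 * (1 + T) ^ 2 * 4) ^ k * 3 ^ k with hC1
  have hC10 : 0 ≤ C1 := by positivity
  refine ⟨2 ^ k + C1, by positivity, ?_⟩
  intro x y a b c h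
  set S := 1 + |a| + |b| + |c| with hS
  set A := 1 + |x| with hA
  set B := K * (1 + T) * S with hB
  have hK0 : 0 ≤ K := by linarith
  have hA1 : 1 ≤ A := by rw [hA]; linarith [abs_nonneg x]
  have hS1 : 1 ≤ S := by rw [hS]; linarith [abs_nonneg a, abs_nonneg b, abs_nonneg c]
  have hKT : 1 ≤ K * (1 + T) := by nlinarith
  have hB1 : 1 ≤ B := by rw [hB]; nlinarith
  have hyAB : |y| ≤ A * B := by
    refine h.trans ?_
    have e1 : T + |a| + |b| + |c| = T + S - 1 := by rw [hS]; ring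
    rw [e1]
    have e2 : |x| ≤ A * 1 := by rw [hA]; linarith
    have e3 : 1 + K * (T + S - 1) ≤ B := by
      rw [hB]
      have : 0 ≤ K * (T * (S - 1)) := mul_nonneg hK0 (mul_nonneg hT (by linarith))
      nlinarith
    calc |x| + K * A * (T + S - 1) ≤ A * 1 + K * A * (T + S - 1) := by gcongr
      _ = A * (1 + K * (T + S - 1)) := by ring
      _ ≤ A * B := by gcongr
  have hone : ∀ z : ℝ, (1 + z ^ 2) ^ k ≤ ((1 + z ^ 2) ^ k) ^ 2 := fun z =>
    le_self_pow₀ (one_le_pow₀ (by nlinarith [sq_nonneg z])) two_ne_zero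
  have hAk : (A ^ k) ^ 2 ≤ 2 ^ k * ((1 + x ^ 2) ^ k) ^ 2 := by
    calc (A ^ k) ^ 2 = (A ^ 2) ^ k := by rw [← pow_mul, ← pow_mul, mul_comm]
      _ ≤ (2 * (1 + x ^ 2)) ^ k := by
          gcongr
          rw [hA]; nlinarith [sq_abs x, sq_nonneg (|x| - 1)]
      _ = 2 ^ k * (1 + x ^ 2) ^ k := mul_pow _ _ _
      _ ≤ _ := by gcongr; exact hone x
  have hBk : (B ^ k) ^ 2 ≤ C1 * (((1 + a ^ 2) ^ k) ^ 2
        + (((1 + b ^ 2) ^ k) ^ 2 + ((1 + c ^ 2) ^ k) ^ 2)) := by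
    have hS2 : S ^ 2 ≤ 4 * ((1 + a ^ 2) + (1 + b ^ 2) + (1 + c ^ 2)) := by
      rw [hS]
      nlinarith [sq_abs a, sq_abs b, sq_abs c, sq_nonneg (|a| - 1), sq_nonneg (|b| - 1),
        sq_nonneg (|c| - 1), sq_nonneg (|a| - |b|), sq_nonneg (|a| - |c|), sq_nonneg (|b| - |c|)]
    calc (B ^ k) ^ 2 = (B ^ 2) ^ k := by rw [← pow_mul, ← pow_mul, mul_comm]
      _ = (K ^ 2 * (1 + T) ^ 2 * S ^ 2) ^ k := by rw [hB]; congr 1; ring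
      _ ≤ (K ^ 2 * (1 + T) ^ 2 * (4 * ((1 + a ^ 2) + (1 + b ^ 2) + (1 + c ^ 2)))) ^ k := by gcongr
      _ = (K ^ 2 * (1 + T) ^ 2 * 4) ^ k * ((1 + a ^ 2) + (1 + b ^ 2) + (1 + c ^ 2)) ^ k := by
          rw [← mul_pow (K ^ 2 * (1 + T) ^ 2 * 4)]; congr 1; ring
      _ ≤ (K ^ 2 * (1 + T) ^ 2 * 4) ^ k *
            (3 ^ k * ((1 + a ^ 2) ^ k + (1 + b ^ 2) ^ k + (1 + c ^ 2) ^ k)) := by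
          gcongr
          exact three_pow k _ _ _ (by positivity) (by positivity) (by positivity)
      _ = C1 * ((1 + a ^ 2) ^ k + (1 + b ^ 2) ^ k + (1 + c ^ 2) ^ k) := by rw [hC1]; ring
      _ ≤ _ := by
          refine mul_le_mul_of_nonneg_left ?_ hC10
          linarith [hone a, hone b, hone c]
  have h1 : |y| ^ p ≤ (A * B) ^ k := by
    calc |y| ^ p ≤ (A * B) ^ p := Real.rpow_le_rpow (abs_nonneg _) hyAB hp
      _ ≤ (A * B) ^ (k:ℝ) := Real.rpow_le_rpow_of_exponent_le (by nlinarith) hpk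
      _ = _ := Real.rpow_natCast _ _
  have h2 : (A * B) ^ k ≤ (A ^ k) ^ 2 + (B ^ k) ^ 2 := by
    rw [mul_pow]; nlinarith [sq_nonneg (A ^ k - B ^ k), sq_nonneg (A ^ k), sq_nonneg (B ^ k)]
  refine h1.trans (h2.trans ((add_le_add hAk hBk).trans ?_))
  have q1 : 0 ≤ ((1 + x ^ 2) ^ k) ^ 2 := by positivity
  have q2 : 0 ≤ ((1 + a ^ 2) ^ k) ^ 2 + (((1 + b ^ 2) ^ k) ^ 2 + ((1 + c ^ 2) ^ k) ^ 2) := by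
    positivity
  have q3 : (0:ℝ) ≤ 2 ^ k := by positivity
  clear_value C1
  clear hBk hAk h1 h2
  generalize ((1 + a ^ 2) ^ k) ^ 2 + (((1 + b ^ 2) ^ k) ^ 2 + ((1 + c ^ 2) ^ k) ^ 2) = R at q2 ⊢
  generalize ((1 + x ^ 2) ^ k) ^ 2 = X at q1 ⊢
  generalize (2:ℝ) ^ k = q at q3 ⊢
  linarith only [mul_nonneg hC10 q1, mul_nonneg q3 q2]

end grid

/-- Moment bound for the Euler–Maruyama scheme:
`E[sup_{t ∈ [0,T]} |X^{(δ)}_t|^p] ≤ C` uniformly in `δ = T/n ∈ (0,1)`. -/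
theorem em_moment_bound
    {Ω : Type*} {m0 : MeasurableSpace Ω}
    (F : Filtration ℝ m0) (P : Measure Ω) [IsProbabilityMeasure P]
    (T : ℝ) (hT : 0 < T)
    (lam : ℝ → ℝ) (hlam_meas : Measurable lam)
    (hlam_pos : ∀ t ∈ Set.Icc (0:ℝ) T, 0 < lam t)
    (lamB : ℝ) (hlamB : ∀ t ∈ Set.Icc (0:ℝ) T, lam t ≤ lamB)
    (W N : ℝ → Ω → ℝ)
    (hW0 : ∀ ω, W 0 ω = 0) (hN0 : ∀ ω, N 0 ω = 0)
    (hW_adapted : ∀ t ∈ Set.Icc (0:ℝ) T, Measurable[F t] (W t))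
    (hN_adapted : ∀ t ∈ Set.Icc (0:ℝ) T, Measurable[F t] (N t))
    (hW_cont : ∀ᵐ ω ∂P, ContinuousOn (fun t => W t ω) (Set.Icc 0 T))
    (hN_mono : ∀ᵐ ω ∂P, ∀ s t : ℝ, 0 ≤ s → s ≤ t → t ≤ T → N s ω ≤ N t ω)
    (hN_rc : ∀ᵐ ω ∂P, ∀ t ∈ Set.Ico (0:ℝ) T,
      Filter.Tendsto (fun u => N u ω) (nhdsWithin t (Set.Ioi t)) (nhds (N t ω)))
    (hN_int : ∀ᵐ ω ∂P, ∀ t ∈ Set.Icc (0:ℝ) T, ∃ k : ℕ, N t ω = k)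
    (hW_gauss : ∀ s t : ℝ, 0 ≤ s → s ≤ t → t ≤ T →
      Measure.map (fun ω => W t ω - W s ω) P = gaussianReal 0 (Real.toNNReal (t - s)))
    (hN_poisson : ∀ s t : ℝ, 0 ≤ s → s ≤ t → t ≤ T →
      Measure.map (fun ω => N t ω - N s ω) P
        = Measure.map (fun k : ℕ => (k : ℝ))
            (poissonMeasure (Real.toNNReal (∫ u in s..t, lam u))))
    (h_indep : ∀ s t : ℝ, 0 ≤ s → s ≤ t → t ≤ T →
      Indep (MeasurableSpace.comap (fun ω => (W t ω - W s ω, N t ω - N s ω)) inferInstance)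
        (F s) P)
    (hWN_indep : ∀ s t : ℝ, 0 ≤ s → s ≤ t → t ≤ T →
      IndepFun (fun ω => W t ω - W s ω) (fun ω => N t ω - N s ω) P)
    (μ σ ρ : ℝ → ℝ) (hμ_meas : Measurable μ) (hσ_meas : Measurable σ) (hρ_meas : Measurable ρ)
    (m : ℕ) (hm : 0 < m) (ζ : Fin m → ℝ) (hζ : StrictMono ζ)
    (hμ_low : ∃ K : NNReal, LipschitzOnWith K μ (Set.Iio (ζ ⟨0, hm⟩)))
    (hμ_high : ∃ K : NNReal, LipschitzOnWith K μ (Set.Ioi (ζ ⟨m - 1, Nat.sub_lt hm one_pos⟩)))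
    (hμ_mid : ∀ (k : Fin m) (h : (k : ℕ) + 1 < m),
      ∃ K : NNReal, LipschitzOnWith K μ (Set.Ioo (ζ k) (ζ ⟨(k : ℕ) + 1, h⟩)))
    (hσ_lip : ∃ K : NNReal, LipschitzWith K σ)
    (hσ_nz : ∀ k : Fin m, σ (ζ k) ≠ 0)
    (hρ_lip : ∃ K : NNReal, LipschitzWith K ρ)
    (ξ : ℝ) (p : ℝ) (hp : 2 ≤ p) :
    ∃ C : ℝ, 0 < C ∧ ∀ n : ℕ, 0 < n → T / n < 1 →
      ∫⁻ ω, ⨆ t : Set.Icc (0:ℝ) T,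
          ENNReal.ofReal (|emProc μ σ ρ W N (T / n) ξ (t : ℝ) ω| ^ p) ∂P
        ≤ ENNReal.ofReal C := by
  obtain ⟨K1, hK1⟩ := lin_growth μ m hm ζ hζ hμ_low hμ_high hμ_mid
  have lipg : ∀ f : ℝ → ℝ, (∃ K : NNReal, LipschitzWith K f) →
      ∃ K : ℝ, ∀ x, |f x| ≤ K * (1 + |x|) := by
    rintro f ⟨K, hK⟩
    have h1 : LipschitzOnWith K f (Set.univ) := hK.lipschitzOnWith
    exact lin_growth f 1 one_pos (fun _ => 0) (Subsingleton.strictMono _)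
      ⟨K, h1.mono (Set.subset_univ _)⟩ ⟨K, h1.mono (Set.subset_univ _)⟩
      (fun k h => ⟨K, h1.mono (Set.subset_univ _)⟩)
  obtain ⟨K2, hK2⟩ := lipg σ hσ_lip
  obtain ⟨K3, hK3⟩ := lipg ρ hρ_lip
  obtain ⟨K, hK, gμ, gσ, gρ⟩ : ∃ K : ℝ, 1 ≤ K ∧ (∀ x, |μ x| ≤ K * (1 + |x|)) ∧
      (∀ x, |σ x| ≤ K * (1 + |x|)) ∧ (∀ x, |ρ x| ≤ K * (1 + |x|)) := by
    refine ⟨max 1 (max K1 (max K2 K3)), le_max_left _ _, fun x => (hK1 x).trans ?_,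
      fun x => (hK2 x).trans ?_, fun x => (hK3 x).trans ?_⟩ <;> gcongr <;> simp
  have D := drv_of F P T hT lam hlam_pos lamB hlamB W N hW0 hN0 hW_adapted hN_adapted hW_gauss
    hN_poisson h_indep
  set k := ⌈p⌉₊ with hk
  obtain ⟨C0, hC0, hfin⟩ := final_alg K T p hK hT.le k (by linarith) (Nat.le_ceil p)
  obtain ⟨CX, hCX, hX⟩ := grid_max D μ σ ρ hμ_meas hσ_meas hρ_meas K hK gμ gσ gρ ξ k
  obtain ⟨CW, hCW, GW, hGWm, hGW, hGWi⟩ := sup_W D hW_cont k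
  obtain ⟨CN, hCN, hN⟩ := grid_max D (fun _ => 0) (fun _ => 0) (fun _ => 1) measurable_const
    measurable_const measurable_const 1 le_rfl (fun x => by simp; positivity)
    (fun x => by simp; positivity) (fun x => by simp) 0 k
  obtain ⟨GN, hGNm, hGN, hGNi⟩ := hN 1 one_pos
  have hGN' : ∀ ω, ENNReal.ofReal (((1 + N T ω ^ 2) ^ k) ^ 2) ≤ GN ω := fun ω => by
    have := hGN 1 le_rfl ω
    rw [grid_N D] at this
    simpa using this
  refine ⟨C0 * (CX + (CW + (CW + CN))) + 1, by positivity, fun n hn _ => ?_⟩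
  obtain ⟨GX, hGXm, hGX, hGXi⟩ := hX n hn
  have hbound : ∫⁻ ω, ⨆ t : Set.Icc (0:ℝ) T,
      ENNReal.ofReal (|emProc μ σ ρ W N (T / n) ξ (t : ℝ) ω| ^ p) ∂P
      ≤ ∫⁻ ω, ENNReal.ofReal C0 * (GX ω + (GW ω + (GW ω + GN ω))) ∂P := by
    refine lintegral_mono_ae ?_
    filter_upwards [hGW, hN_mono] with ω h1 h2
    refine iSup_le ?_
    rintro ⟨t, ht⟩
    obtain ⟨f1, f2, f3⟩ := floor_grid hT hn ht
    have hs0 : 0 ≤ lastGrid (T / n) t := by unfold lastGrid; positivity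
    have hsT : lastGrid (T / n) t ∈ Set.Icc 0 T := ⟨hs0, f2.trans ht.2⟩
    have hdT : T / n ≤ T := div_le_self hT.le (by exact_mod_cast hn)
    have hN1 : |N t ω - N (lastGrid (T / n) t) ω| ≤ |N T ω| := by
      have a1 := h2 _ _ hs0 f2 ht.2
      have a2 := h2 _ _ le_rfl hs0 hsT.2
      have a3 := h2 _ _ ht.1 ht.2 le_rfl
      rw [hN0] at a2
      rw [abs_of_nonneg (by linarith), abs_of_nonneg (by linarith)]
      linarith
    have hst := hfin (emGrid μ σ ρ W N (T / n) ξ (⌊t / (T / n)⌋.toNat) ω)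
      (emProc μ σ ρ W N (T / n) ξ t ω) (W t ω) (W (lastGrid (T / n) t) ω) (N T ω) ?_
    · refine (ENNReal.ofReal_le_ofReal hst).trans ?_
      rw [ENNReal.ofReal_mul hC0, ENNReal.ofReal_add (by positivity) (by positivity),
        ENNReal.ofReal_add (by positivity) (by positivity),
        ENNReal.ofReal_add (by positivity) (by positivity)]
      gcongr
      · exact hGX _ f1 ω
      · exact h1 t ht
      · exact h1 _ hsT
      · exact hGN' ω
    · unfold emProc
      set x := emGrid μ σ ρ W N (T / n) ξ (⌊t / (T / n)⌋.toNat) ω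
      have c1 : |μ x * (t - lastGrid (T / n) t)| ≤ K * (1 + |x|) * T := by
        rw [abs_mul, abs_of_nonneg (a := t - lastGrid (T / n) t) (by linarith)]
        gcongr
        · exact gμ x
        · linarith
      have c2 : |σ x * (W t ω - W (lastGrid (T / n) t) ω)|
          ≤ K * (1 + |x|) * (|W t ω| + |W (lastGrid (T / n) t) ω|) := by
        rw [abs_mul]
        gcongr
        · exact gσ x
        · exact abs_sub _ _
      have c3 : |ρ x * (N t ω - N (lastGrid (T / n) t) ω)| ≤ K * (1 + |x|) * |N T ω| := by
        rw [abs_mul]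
        gcongr
        exact gρ x
      refine (abs_add_le _ _).trans ?_
      refine (add_le_add_left ((abs_add_le _ _).trans (add_le_add_left (abs_add_le _ _) _)) _).trans ?_
      linarith
  refine hbound.trans ?_
  rw [lintegral_const_mul _ (by fun_prop), lintegral_add_left hGXm, lintegral_add_left hGWm,
    lintegral_add_left hGWm]
  calc _ ≤ ENNReal.ofReal C0 * (ENNReal.ofReal CX + (ENNReal.ofReal CW
        + (ENNReal.ofReal CW + ENNReal.ofReal CN))) := by gcongr
    _ = ENNReal.ofReal (C0 * (CX + (CW + (CW + CN)))) := by
      rw [ENNReal.ofReal_mul hC0, ENNReal.ofReal_add hCX (by positivity),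
        ENNReal.ofReal_add hCW (by positivity), ENNReal.ofReal_add hCW hCN]
    _ ≤ _ := ENNReal.ofReal_le_ofReal (by linarith)
end

section
/- Let p ∈ [2,∞). There exists a constant C ∈ (0,∞) such that for every n ∈ ℕ with δ = T/n ∈ (0,1) and all s, t ∈ [0,T] with s < t, the Euler–Maruyama scheme satisfies E[ |X^{(δ)}_t − X^{(δ)}_s|^p ] ≤ C · (t − s). -/
open MeasureTheory ProbabilityTheory

lemma em_scalar {p : ℝ} (hp : 2 ≤ p) (u : ℝ) :
    |1 + u| ^ p ≤ 1 + p * u + ((p + 1) ^ p + p ^ 2) * (u ^ 2 + |u| ^ p) := by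
  have hp0 : 0 < p := by linarith
  have hup : 0 ≤ |u| ^ p := by positivity
  have hpp : 0 ≤ (p + 1) ^ p := by positivity
  by_cases h : |p * u| ≤ 1
  · have h1 := Real.abs_exp_sub_one_sub_id_le h
    have h2 : |u| ≤ 1 / 2 := by
      rw [abs_mul, abs_of_pos hp0] at h
      nlinarith [abs_nonneg u]
    have h3 : 0 ≤ 1 + u := by linarith [(abs_le.1 h2).1]
    have h4 : |1 + u| ^ p ≤ Real.exp (p * u) := by
      rw [abs_of_nonneg h3, mul_comm, Real.exp_mul]
      apply Real.rpow_le_rpow h3 _ hp0.le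
      linarith [Real.add_one_le_exp u]
    have h5 := (abs_le.1 h1).2
    have : 0 ≤ (p + 1) ^ p * (u ^ 2 + |u| ^ p) := by positivity
    have : 0 ≤ p ^ 2 * |u| ^ p := by positivity
    nlinarith
  · push Not at h
    have h1 : |1 + u| ≤ (p + 1) * |u| := by
      have := abs_add_le 1 u
      rw [abs_mul, abs_of_pos hp0] at h
      rw [abs_one] at this
      nlinarith
    have h2 : |1 + u| ^ p ≤ (p + 1) ^ p * |u| ^ p := by
      rw [← Real.mul_rpow (by positivity) (by positivity)]
      exact Real.rpow_le_rpow (abs_nonneg _) h1 hp0.le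
    have h3 : -(p * u) ≤ p ^ 2 * u ^ 2 := by
      have : |p * u| ≤ |p * u| ^ 2 := by nlinarith
      rw [sq_abs] at this
      nlinarith [neg_abs_le (p * u)]
    have : 0 ≤ (p + 1) ^ p * u ^ 2 := by positivity
    have : 0 ≤ p ^ 2 * |u| ^ p := by positivity
    nlinarith

lemma em_young {p q x y : ℝ} (hq : 0 ≤ q) (hqp : q ≤ p) (hx : 0 ≤ x) (hy : 0 ≤ y) :
    x ^ (p - q) * y ^ q ≤ x ^ p + y ^ p := by
  have h1 : 0 ≤ x ^ p := by positivity
  have h2 : 0 ≤ y ^ p := by positivity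
  have key : ∀ m : ℝ, 0 ≤ m → x ≤ m → y ≤ m → x ^ (p - q) * y ^ q ≤ m ^ p := by
    intro m hm hxm hym
    calc x ^ (p - q) * y ^ q ≤ m ^ (p - q) * m ^ q := by
          apply mul_le_mul (Real.rpow_le_rpow hx hxm (by linarith)) (Real.rpow_le_rpow hy hym hq)
            (by positivity) (by positivity)
      _ = m ^ p := by
          rw [← Real.rpow_add_of_nonneg hm (by linarith) hq]; congr 1; ring
  rcases le_total x y with h | h
  · linarith [key y hy h le_rfl]
  · linarith [key x hx le_rfl h]

lemma em_key {p : ℝ} (hp : 2 ≤ p) (y : ℝ) : ∃ θ : ℝ, |θ| ≤ p * |y| ^ (p - 1) ∧ ∀ z : ℝ,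
    |y + z| ^ p ≤ |y| ^ p + θ * z + ((p + 1) ^ p + p ^ 2) * (|y| ^ (p - 2) * z ^ 2 + |z| ^ p) := by
  have hp0 : 0 < p := by linarith
  have hpp : 1 ≤ (p + 1) ^ p := Real.one_le_rpow (by linarith) (by linarith)
  by_cases hy : y = 0
  · subst hy
    refine ⟨0, ?_, fun z => ?_⟩
    · simp only [abs_zero]; positivity
    · have h0 : (0:ℝ) ≤ |z| ^ p := by positivity
      have h1 : (0:ℝ) ≤ |(0:ℝ)| ^ (p - 2) * z ^ 2 := by positivity
      have h2 : (0:ℝ) ≤ |(0:ℝ)| ^ p := by positivity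
      rw [zero_add]
      have h3 : (0:ℝ) ≤ ((p + 1) ^ p + p ^ 2) * (|(0:ℝ)| ^ (p - 2) * z ^ 2) := by positivity
      have h4 : (0:ℝ) ≤ (p ^ 2) * |z| ^ p := by positivity
      nlinarith
  · have hy' : 0 < |y| := abs_pos.2 hy
    refine ⟨p * |y| ^ p / y, ?_, fun z => ?_⟩
    · rw [abs_div, abs_mul, abs_of_pos hp0, abs_of_nonneg (by positivity : 0 ≤ |y| ^ p),
        Real.rpow_sub_one hy'.ne', mul_div_assoc]
    · have h := em_scalar hp (z / y)
      have h1 : |y + z| = |y| * |1 + z / y| := by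
        rw [← abs_mul]; congr 1; field_simp
      have h2 : |y| ^ (p - 2) = |y| ^ p / y ^ 2 := by
        rw [Real.rpow_sub hy', ← sq_abs y]; norm_num
      have h3 : |z| ^ p = |y| ^ p * |z / y| ^ p := by
        rw [← Real.mul_rpow (by positivity) (by positivity), ← abs_mul]; congr 2; field_simp
      rw [h1, Real.mul_rpow (by positivity) (by positivity), h2, h3]
      have h4 := mul_le_mul_of_nonneg_left h (by positivity : 0 ≤ |y| ^ p)
      refine h4.trans (le_of_eq ?_)
      field_simp

lemma em_sum3 {p : ℝ} (hp : 0 ≤ p) (a b c : ℝ) :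
    |a + b + c| ^ p ≤ 3 ^ p * (|a| ^ p + |b| ^ p + |c| ^ p) := by
  have ha : 0 ≤ |a| ^ p := by positivity
  have hb : 0 ≤ |b| ^ p := by positivity
  have hc : 0 ≤ |c| ^ p := by positivity
  have key : ∀ m : ℝ, |a| ≤ m → |b| ≤ m → |c| ≤ m → |a + b + c| ^ p ≤ 3 ^ p * m ^ p := by
    intro m h1 h2 h3
    have hm : 0 ≤ m := (abs_nonneg a).trans h1
    rw [← Real.mul_rpow (by norm_num) hm]
    apply Real.rpow_le_rpow (abs_nonneg _) _ hp
    have := abs_add_three a b c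
    linarith
  have h3 : (0:ℝ) ≤ 3 ^ p := by positivity
  rcases le_total |a| |b| with h | h
  · rcases le_total |b| |c| with h' | h'
    · have := key |c| (h.trans h') h' le_rfl
      nlinarith
    · have := key |b| h le_rfl h'
      nlinarith
  · rcases le_total |a| |c| with h' | h'
    · have := key |c| h' (h.trans h') le_rfl
      nlinarith
    · have := key |a| le_rfl h h'
      nlinarith

set_option maxHeartbeats 2000000 in
lemma em_pw {p : ℝ} (hp : 2 ≤ p) : ∃ C : ℝ, 0 < C ∧ ∀ y a b c : ℝ, ∃ θ : ℝ,
    ∀ h g k : ℝ, 0 ≤ h → h ≤ 1 →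
      |y + (a * h + b * g + c * k)| ^ p ≤ |y| ^ p + θ * g
        + C * (h + (g ^ 2 + |g| ^ p) + (|k| + k ^ 2 + |k| ^ p))
          * (|y| ^ p + |a| ^ p + |b| ^ p + |c| ^ p) := by
  have hp0 : 0 < p := by linarith
  have hpp : 0 < (p + 1) ^ p := by positivity
  set D := (p + 1) ^ p + p ^ 2 with hD
  have hD0 : 0 < D := by positivity
  have h3p : (0:ℝ) < 3 ^ p := by positivity
  refine ⟨p + D * (3 + 3 ^ p), by positivity, fun y a b c => ?_⟩
  obtain ⟨θ, hθ, hk⟩ := em_key hp y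
  refine ⟨θ * b, fun h g k h0 h1 => (hk _).trans ?_⟩
  rw [← hD]
  set Y := |y| ^ p
  set A := |a| ^ p
  set B := |b| ^ p
  set E := |c| ^ p
  have hY : 0 ≤ Y := by positivity
  have hA : 0 ≤ A := by positivity
  have hB : 0 ≤ B := by positivity
  have hE : 0 ≤ E := by positivity
  set S := Y + A + B + E with hS
  have y1 : ∀ v : ℝ, |y| ^ (p - 1) * |v| ≤ Y + |v| ^ p := by
    intro v
    have := em_young (p := p) (q := 1) zero_le_one (by linarith) (abs_nonneg y) (abs_nonneg v)
    rwa [Real.rpow_one] at this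
  have y2 : ∀ v : ℝ, |y| ^ (p - 2) * v ^ 2 ≤ Y + |v| ^ p := by
    intro v
    have := em_young (p := p) (q := 2) (by norm_num) (by linarith) (abs_nonneg y) (abs_nonneg v)
    rwa [Real.rpow_two, sq_abs] at this
  have t1 : ∀ v x : ℝ, |v| ^ p ≤ S - Y → θ * (v * x) ≤ p * S * |x| := by
    intro v x hv
    calc θ * (v * x) ≤ |θ * (v * x)| := le_abs_self _
      _ = |θ| * |v| * |x| := by rw [abs_mul, abs_mul, mul_assoc]
      _ ≤ (p * |y| ^ (p - 1)) * |v| * |x| := by gcongr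
      _ = p * (|y| ^ (p - 1) * |v|) * |x| := by ring
      _ ≤ p * S * |x| := by
        have := y1 v
        gcongr
        linarith
  have t2 : ∀ v x : ℝ, |v| ^ p ≤ S - Y → |y| ^ (p - 2) * (v * x) ^ 2 ≤ S * x ^ 2 := by
    intro v x hv
    calc |y| ^ (p - 2) * (v * x) ^ 2 = (|y| ^ (p - 2) * v ^ 2) * x ^ 2 := by ring
      _ ≤ S * x ^ 2 := by
        have := y2 v
        gcongr
        linarith
  have t3 : ∀ v x : ℝ, |v| ^ p ≤ S - Y → |v * x| ^ p ≤ S * |x| ^ p := by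
    intro v x hv
    rw [abs_mul, Real.mul_rpow (abs_nonneg _) (abs_nonneg _)]
    gcongr
    linarith
  have ha : |a| ^ p ≤ S - Y := by simp only [hS]; linarith
  have hb : |b| ^ p ≤ S - Y := by simp only [hS]; linarith
  have hc : |c| ^ p ≤ S - Y := by simp only [hS]; linarith
  have hS0 : 0 ≤ S := by positivity
  have s1 := t1 a h ha
  have s2 := t1 c k hc
  have q1 := t2 a h ha
  have q2 := t2 b g hb
  have q3 := t2 c k hc
  have r1 := t3 a h ha
  have r2 := t3 b g hb
  have r3 := t3 c k hc
  have hsq : h ^ 2 ≤ h := by nlinarith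
  have hhp : |h| ^ p ≤ h := by
    rw [abs_of_nonneg h0]
    calc h ^ p ≤ h ^ (1:ℝ) := by
          rcases h0.eq_or_lt with h' | h'
          · rw [← h', Real.zero_rpow hp0.ne', Real.zero_rpow one_ne_zero]
          · exact Real.rpow_le_rpow_of_exponent_ge h' h1 (by linarith)
      _ = h := Real.rpow_one h
  rw [abs_of_nonneg h0] at s1
  set Q := h + (g ^ 2 + |g| ^ p) + (|k| + k ^ 2 + |k| ^ p) with hQ
  have gp : 0 ≤ |g| ^ p := by positivity
  have kp : 0 ≤ |k| ^ p := by positivity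
  have e2 : |y| ^ (p - 2) * (a * h + b * g + c * k) ^ 2 ≤ 3 * (S * Q) := by
    have : (a * h + b * g + c * k) ^ 2 ≤ 3 * ((a * h) ^ 2 + (b * g) ^ 2 + (c * k) ^ 2) := by
      nlinarith [sq_nonneg (a * h - b * g), sq_nonneg (a * h - c * k), sq_nonneg (b * g - c * k)]
    calc |y| ^ (p - 2) * (a * h + b * g + c * k) ^ 2
        ≤ |y| ^ (p - 2) * (3 * ((a * h) ^ 2 + (b * g) ^ 2 + (c * k) ^ 2)) := by gcongr
      _ ≤ 3 * (S * (h ^ 2 + g ^ 2 + k ^ 2)) := by linarith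
      _ ≤ 3 * (S * Q) := by
        have : h ^ 2 + g ^ 2 + k ^ 2 ≤ Q := by
          simp only [hQ]; linarith [abs_nonneg k]
        gcongr
  have e3 : |a * h + b * g + c * k| ^ p ≤ 3 ^ p * (S * Q) := by
    refine (em_sum3 hp0.le _ _ _).trans ?_
    gcongr
    calc |a * h| ^ p + |b * g| ^ p + |c * k| ^ p ≤ S * (|h| ^ p + |g| ^ p + |k| ^ p) := by linarith
      _ ≤ S * Q := by
        have : |h| ^ p + |g| ^ p + |k| ^ p ≤ Q := by
          simp only [hQ]; linarith [abs_nonneg k, sq_nonneg k, sq_nonneg g]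
        gcongr
  have e1 : p * S * h + p * S * |k| ≤ p * (S * Q) := by
    have : h + |k| ≤ Q := by
      simp only [hQ]; linarith [sq_nonneg k, sq_nonneg g]
    calc p * S * h + p * S * |k| = p * (S * (h + |k|)) := by ring
      _ ≤ _ := by gcongr
  have e4 : D * (|y| ^ (p - 2) * (a * h + b * g + c * k) ^ 2 + |a * h + b * g + c * k| ^ p)
      ≤ D * (3 * (S * Q) + 3 ^ p * (S * Q)) := by gcongr
  calc Y + θ * (a * h + b * g + c * k) + D * (|y| ^ (p - 2) * (a * h + b * g + c * k) ^ 2 + |a * h + b * g + c * k| ^ p)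
      ≤ Y + θ * b * g + p * (S * Q) + D * (3 * (S * Q) + 3 ^ p * (S * Q)) := by linarith
    _ = _ := by ring

lemma em_gauss {p : ℝ} (hp : 2 ≤ p) : ∃ A : ℝ, 0 ≤ A ∧ ∀ h : ℝ, 0 ≤ h → h ≤ 1 →
    Integrable (fun x : ℝ => x ^ 2 + |x| ^ p) (gaussianReal 0 (Real.toNNReal h)) ∧
    ∫ x, (x ^ 2 + |x| ^ p) ∂(gaussianReal 0 (Real.toNNReal h)) ≤ A * h := by
  have hp0 : 0 < p := by linarith
  have h_integ : ∀ v, Integrable (fun x : ℝ => x ^ 2 + |x| ^ p) (gaussianReal 0 v) := by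
    intro v
    apply Integrable.add
    · exact (memLp_id_gaussianReal (μ := 0) (v := v) 2).integrable_sq
    · have := (memLp_id_gaussianReal (μ := 0) (v := v) p.toNNReal).integrable_norm_rpow
        (by simpa using hp0) (by simp)
      simpa [hp0.le] using this
  refine ⟨∫ x, (x ^ 2 + |x| ^ p) ∂(gaussianReal 0 1), integral_nonneg fun x => by positivity, fun h h0 h1 => ⟨h_integ _, ?_⟩⟩
  have hm : gaussianReal 0 (Real.toNNReal h) = (gaussianReal 0 1).map (fun x => Real.sqrt h * x) := by
    rw [gaussianReal_map_const_mul]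
    congr 1
    · simp
    · ext; simp [Real.sq_sqrt h0, h0]
  rw [hm, integral_map (by fun_prop) (by rw [← hm]; exact (h_integ _).1), mul_comm, ← integral_const_mul]
  apply integral_mono_of_nonneg
  · exact Filter.Eventually.of_forall fun x => by positivity
  · exact (h_integ 1).const_mul h
  · refine Filter.Eventually.of_forall fun x => ?_
    have e1 : (Real.sqrt h * x) ^ 2 = h * x ^ 2 := by rw [mul_pow, Real.sq_sqrt h0]
    have e2 : |Real.sqrt h * x| ^ p ≤ h * |x| ^ p := by
      rw [abs_mul, Real.mul_rpow (abs_nonneg _) (abs_nonneg _)]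
      gcongr
      rw [abs_of_nonneg (Real.sqrt_nonneg h), Real.sqrt_eq_rpow, ← Real.rpow_mul h0]
      calc h ^ (1 / 2 * p) ≤ h ^ (1:ℝ) := by
            rcases h0.eq_or_lt with h' | h'
            · rw [← h', Real.zero_rpow (by positivity), Real.zero_rpow one_ne_zero]
            · exact Real.rpow_le_rpow_of_exponent_ge h' h1 (by linarith)
        _ = h := Real.rpow_one h
    simp only
    rw [e1]; linarith

lemma em_pois {p : ℝ} (hp : 2 ≤ p) (L : ℝ) (hL : 0 ≤ L) : ∃ A : ℝ, 0 ≤ A ∧ ∀ r : ℝ, 0 ≤ r → r ≤ L →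
    Integrable (fun x : ℝ => |x| + x ^ 2 + |x| ^ p)
      (Measure.map (fun k : ℕ => (k : ℝ)) (poissonMeasure (Real.toNNReal r))) ∧
    ∫ x, (|x| + x ^ 2 + |x| ^ p) ∂(Measure.map (fun k : ℕ => (k : ℝ)) (poissonMeasure (Real.toNNReal r))) ≤ A * r := by
  have hp0 : 0 < p := by linarith
  have hpw : ∀ k : ℕ, |(k:ℝ)| + (k:ℝ) ^ 2 + |(k:ℝ)| ^ p ≤ 6 * p ^ p * (Real.exp 1 ^ k - 1) := by
    intro k
    rcases Nat.eq_zero_or_pos k with rfl | hk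
    · simp [hp0.ne']
    · have hk1 : (1:ℝ) ≤ k := by exact_mod_cast hk
      rw [abs_of_nonneg (by positivity)]
      have a1 : (k:ℝ) ≤ (k:ℝ) ^ p := by
        simpa using Real.rpow_le_rpow_of_exponent_le hk1 (by linarith : 1 ≤ p)
      have a2 : (k:ℝ) ^ 2 ≤ (k:ℝ) ^ p := by
        simpa using Real.rpow_le_rpow_of_exponent_le hk1 hp
      have a3 : (k:ℝ) ^ p ≤ p ^ p * Real.exp k := by
        have : (k:ℝ) / p ≤ Real.exp (k / p) := by linarith [Real.add_one_le_exp ((k:ℝ) / p)]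
        have := Real.rpow_le_rpow (by positivity) this hp0.le
        rw [← Real.exp_mul, div_mul_cancel₀ _ hp0.ne', Real.div_rpow (by positivity) hp0.le,
          div_le_iff₀ (by positivity)] at this
        linarith
      have a4 : Real.exp 1 ^ k = Real.exp k := by rw [← Real.exp_nat_mul, mul_one]
      have a5 : 2 ≤ Real.exp k := by linarith [Real.add_one_le_exp (k:ℝ)]
      rw [a4]
      have : p ^ p * Real.exp k ≤ p ^ p * (2 * (Real.exp k - 1)) := by
        gcongr; linarith
      linarith
  have hsum : ∀ r : NNReal, HasSum (fun n : ℕ => Real.exp (-r) * r ^ n / (n.factorial) * (Real.exp 1 ^ n - 1))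
      (Real.exp (r * (Real.exp 1 - 1)) - 1) := by
    intro r
    have h1 := hasSum_one_poissonMeasure r
    have h2 := (NormedSpace.expSeries_div_hasSum_exp ((r : ℝ) * Real.exp 1)).mul_left (Real.exp (-r))
    rw [← Real.exp_eq_exp_ℝ, ← Real.exp_add] at h2
    have h3 := h2.sub h1
    have e1 : Real.exp (r * (Real.exp 1 - 1)) = Real.exp (-r + r * Real.exp 1) := by
      congr 1; ring
    have e2 : (fun n : ℕ => Real.exp (-r) * r ^ n / (n.factorial) * (Real.exp 1 ^ n - 1))
        = fun n : ℕ => Real.exp (-r) * ((r * Real.exp 1) ^ n / n.factorial)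
          - Real.exp (-r) * r ^ n / (n.factorial) := by
      funext n; rw [mul_pow]; ring
    rw [e1, e2]
    exact h3
  have h_integ : ∀ r : NNReal, Integrable (fun n : ℕ => Real.exp 1 ^ n - 1) (poissonMeasure r) := by
    intro r
    rw [integrable_poissonMeasure_iff]
    convert (hsum r).summable using 3 with n
    rw [Real.norm_eq_abs, abs_of_nonneg]
    linarith [one_le_pow₀ (n := n) (Real.one_le_exp zero_le_one)]
  have hval : ∀ r : NNReal, ∫ n : ℕ, (Real.exp 1 ^ n - 1) ∂(poissonMeasure r) = Real.exp (r * (Real.exp 1 - 1)) - 1 := by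
    intro r
    rw [integral_poissonMeasure]
    simpa using (hsum r).tsum_eq
  have hmeas : Measurable (fun x : ℝ => |x| + x ^ 2 + |x| ^ p) := by fun_prop
  have h_integ2 : ∀ r : NNReal, Integrable (fun k : ℕ => |(k:ℝ)| + (k:ℝ) ^ 2 + |(k:ℝ)| ^ p) (poissonMeasure r) := by
    intro r
    refine ((h_integ r).const_mul (6 * p ^ p)).mono' (by fun_prop) (Filter.Eventually.of_forall fun k => ?_)
    rw [Real.norm_eq_abs, abs_of_nonneg (by positivity)]
    exact hpw k
  have he1 : 0 ≤ Real.exp 1 - 1 := by linarith [Real.one_le_exp zero_le_one]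
  refine ⟨6 * p ^ p * ((Real.exp 1 - 1) * Real.exp (L * (Real.exp 1 - 1))), by positivity, fun r h0 h1 => ⟨?_, ?_⟩⟩
  · rw [integrable_map_measure hmeas.aestronglyMeasurable (by fun_prop)]
    exact h_integ2 _
  · rw [integral_map (by fun_prop) hmeas.aestronglyMeasurable]
    calc _ ≤ ∫ k : ℕ, 6 * p ^ p * (Real.exp 1 ^ k - 1) ∂(poissonMeasure (Real.toNNReal r)) :=
          integral_mono (h_integ2 _) ((h_integ _).const_mul _) hpw
      _ = 6 * p ^ p * (Real.exp (r * (Real.exp 1 - 1)) - 1) := by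
          rw [integral_const_mul, hval, Real.coe_toNNReal _ h0]
      _ ≤ _ := by
          rw [mul_assoc (6 * p ^ p)]
          gcongr
          set x := r * (Real.exp 1 - 1) with hx
          have hx0 : 0 ≤ x := by positivity
          have b1 : Real.exp x - 1 ≤ x * Real.exp x := by
            have := Real.add_one_le_exp (-x)
            have h3 : Real.exp (-x) * Real.exp x = 1 := by rw [← Real.exp_add]; simp
            nlinarith [Real.exp_pos x]
          have b2 : Real.exp x ≤ Real.exp (L * (Real.exp 1 - 1)) := by
            apply Real.exp_le_exp.2; rw [hx]; gcongr
          calc Real.exp x - 1 ≤ x * Real.exp x := b1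
            _ ≤ x * Real.exp (L * (Real.exp 1 - 1)) := by gcongr
            _ = _ := by rw [hx]; ring

lemma em_det {Ω : Type*} {m0 : MeasurableSpace Ω} (P : Measure Ω) [IsProbabilityMeasure P]
    {p : ℝ} (hp : 2 ≤ p) (L : ℝ) (hL : 0 ≤ L) : ∃ C : ℝ, 0 < C ∧ ∀ (G K : Ω → ℝ) (h r : ℝ),
    Measurable G → Measurable K → 0 ≤ h → h ≤ 1 → 0 ≤ r → r ≤ L * h →
    Measure.map G P = gaussianReal 0 (Real.toNNReal h) →
    Measure.map K P = Measure.map (fun k : ℕ => (k : ℝ)) (poissonMeasure (Real.toNNReal r)) →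
    ∀ y a b c : ℝ, ∫⁻ ω, ENNReal.ofReal (|y + (a * h + b * G ω + c * K ω)| ^ p) ∂P
      ≤ ENNReal.ofReal (|y| ^ p + C * h * (|y| ^ p + |a| ^ p + |b| ^ p + |c| ^ p)) := by
  obtain ⟨C, hC, hpw⟩ := em_pw hp
  obtain ⟨A, hA, hg⟩ := em_gauss hp
  obtain ⟨B, hB, hk⟩ := em_pois hp L hL
  refine ⟨C * (1 + A + B * L), by positivity, ?_⟩
  intro G K h r mG mK h0 h1 r0 r1 lG lK y a b c
  obtain ⟨iG, bG⟩ := hg h h0 h1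
  obtain ⟨iK, bK⟩ := hk r r0 (r1.trans (by nlinarith))
  rw [← lG] at iG bG
  rw [← lK] at iK bK
  have iG1 : Integrable (fun ω => G ω) P := by
    have : Integrable (fun x : ℝ => x) (Measure.map G P) := by
      rw [lG]
      have := (memLp_id_gaussianReal (μ := 0) (v := h.toNNReal) 1).integrable (by simp)
      exact this
    exact this.comp_measurable mG
  have bG1 : ∫ ω, G ω ∂P = 0 := by
    have := integral_map (f := fun x : ℝ => x) (mG.aemeasurable (μ := P)) (by fun_prop)
    rw [← this, lG, integral_id_gaussianReal]
  have iG2 : Integrable (fun ω => (G ω) ^ 2 + |G ω| ^ p) P := iG.comp_measurable mG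
  have iK2 : Integrable (fun ω => |K ω| + (K ω) ^ 2 + |K ω| ^ p) P := iK.comp_measurable mK
  rw [integral_map mG.aemeasurable (by fun_prop)] at bG
  rw [integral_map mK.aemeasurable (by fun_prop)] at bK
  obtain ⟨θ, hθ⟩ := hpw y a b c
  set S := |y| ^ p + |a| ^ p + |b| ^ p + |c| ^ p with hS
  have hS0 : 0 ≤ S := by positivity
  set Φ : Ω → ℝ := fun ω => (|y| ^ p + θ * G ω)
    + (C * S) * ((h + ((G ω) ^ 2 + |G ω| ^ p)) + (|K ω| + (K ω) ^ 2 + |K ω| ^ p)) with hΦ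
  have hle : ∀ ω, |y + (a * h + b * G ω + c * K ω)| ^ p ≤ Φ ω := by
    intro ω
    refine (hθ h (G ω) (K ω) h0 h1).trans (le_of_eq ?_)
    simp only [hΦ]; ring
  have i1 : Integrable (fun ω => |y| ^ p + θ * G ω) P := (integrable_const _).add (iG1.const_mul θ)
  have i2 : Integrable (fun ω => h + ((G ω) ^ 2 + |G ω| ^ p)) P := (integrable_const _).add iG2
  have i3 : Integrable (fun ω => (h + ((G ω) ^ 2 + |G ω| ^ p)) + (|K ω| + (K ω) ^ 2 + |K ω| ^ p)) P :=
    i2.add iK2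
  have iΦ : Integrable Φ P := i1.add (i3.const_mul _)
  calc _ ≤ ∫⁻ ω, ENNReal.ofReal (Φ ω) ∂P :=
        lintegral_mono fun ω => ENNReal.ofReal_le_ofReal (hle ω)
    _ = ENNReal.ofReal (∫ ω, Φ ω ∂P) := by
        rw [ofReal_integral_eq_lintegral_ofReal iΦ]
        exact Filter.Eventually.of_forall fun ω => le_trans (by positivity) (hle ω)
    _ ≤ _ := by
        apply ENNReal.ofReal_le_ofReal
        have e : ∫ ω, Φ ω ∂P = |y| ^ p + (C * S) * (h + ∫ ω, ((G ω) ^ 2 + |G ω| ^ p) ∂P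
            + ∫ ω, (|K ω| + (K ω) ^ 2 + |K ω| ^ p) ∂P) := by
          simp only [hΦ]
          rw [integral_add i1 (i3.const_mul _), integral_const_mul, integral_add i2 iK2,
            integral_add (integrable_const _) iG2, integral_add (integrable_const _) (iG1.const_mul θ),
            integral_const_mul, bG1]
          simp
        rw [e]
        have : h + ∫ ω, ((G ω) ^ 2 + |G ω| ^ p) ∂P
            + ∫ ω, (|K ω| + (K ω) ^ 2 + |K ω| ^ p) ∂P ≤ h + A * h + B * (L * h) := by
          have := mul_le_mul_of_nonneg_left r1 hB
          linarith
        have := mul_le_mul_of_nonneg_left this (by positivity : 0 ≤ C * S)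
        linarith

/-- Linear growth on a set. -/
def emLG (f : ℝ → ℝ) (S : Set ℝ) : Prop := ∃ L : ℝ, 0 ≤ L ∧ ∀ x ∈ S, |f x| ≤ L * (1 + |x|)

lemma emLG_lip {f : ℝ → ℝ} {S : Set ℝ} {K : NNReal} (h : LipschitzOnWith K f S) : emLG f S := by
  rcases S.eq_empty_or_nonempty with rfl | ⟨x0, hx0⟩
  · exact ⟨0, le_rfl, by simp⟩
  · refine ⟨|f x0| + K * (1 + |x0|), by positivity, fun x hx => ?_⟩
    have h1 := h.dist_le_mul x hx x0 hx0
    rw [Real.dist_eq, Real.dist_eq] at h1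
    have h2 : |f x| ≤ |f x0| + |f x - f x0| := by
      have := abs_add_le (f x0) (f x - f x0)
      simpa using this
    have h3 : |x - x0| ≤ |x| + |x0| := abs_sub x x0
    have hK : (0:ℝ) ≤ K := K.2
    have h4 : (K:ℝ) * |x - x0| ≤ K * ((1 + |x0|) * (1 + |x|)) := by
      gcongr
      nlinarith [abs_nonneg x, abs_nonneg x0, mul_nonneg (abs_nonneg x) (abs_nonneg x0)]
    nlinarith [abs_nonneg x, abs_nonneg (f x0), mul_nonneg (abs_nonneg x) (abs_nonneg (f x0))]

lemma emLG_iUnion {f : ℝ → ℝ} {ι : Type*} [Fintype ι] {S : ι → Set ℝ} (h : ∀ i, emLG f (S i)) :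
    emLG f (⋃ i, S i) := by
  choose L hL hb using h
  refine ⟨∑ i, L i, Finset.sum_nonneg fun i _ => hL i, fun x hx => ?_⟩
  obtain ⟨i, hi⟩ := Set.mem_iUnion.1 hx
  refine (hb i x hi).trans ?_
  gcongr
  exact Finset.single_le_sum (fun i _ => hL i) (Finset.mem_univ i)

lemma emLG_union {f : ℝ → ℝ} {S S' : Set ℝ} (h : emLG f S) (h' : emLG f S') : emLG f (S ∪ S') := by
  obtain ⟨L, hL, hb⟩ := h
  obtain ⟨L', hL', hb'⟩ := h'
  refine ⟨L + L', by positivity, fun x hx => ?_⟩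
  have : 0 ≤ |x| := abs_nonneg x
  rcases hx with hx | hx
  · have := hb x hx; nlinarith
  · have := hb' x hx; nlinarith

lemma emLG_mu (μ : ℝ → ℝ) (m : ℕ) (hm : 0 < m) (ζ : Fin m → ℝ)
    (hμ_low : ∃ K : NNReal, LipschitzOnWith K μ (Set.Iio (ζ ⟨0, hm⟩)))
    (hμ_high : ∃ K : NNReal, LipschitzOnWith K μ (Set.Ioi (ζ ⟨m - 1, Nat.sub_lt hm one_pos⟩)))
    (hμ_mid : ∀ (k : Fin m) (h : (k : ℕ) + 1 < m),
      ∃ K : NNReal, LipschitzOnWith K μ (Set.Ioo (ζ k) (ζ ⟨(k : ℕ) + 1, h⟩))) :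
    emLG μ Set.univ := by
  obtain ⟨K1, h1⟩ := hμ_low
  obtain ⟨K2, h2⟩ := hμ_high
  have h3 : ∀ k : Fin m, emLG μ (if h : (k : ℕ) + 1 < m then Set.Ioo (ζ k) (ζ ⟨(k : ℕ) + 1, h⟩) else ∅) := by
    intro k
    by_cases h : (k : ℕ) + 1 < m
    · rw [dif_pos h]
      obtain ⟨K, hK⟩ := hμ_mid k h
      exact emLG_lip hK
    · rw [dif_neg h]; exact ⟨0, le_rfl, by simp⟩
  have h4 : ∀ k : Fin m, emLG μ {ζ k} := by
    intro k
    refine ⟨|μ (ζ k)|, abs_nonneg _, fun x hx => ?_⟩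
    rw [Set.mem_singleton_iff.1 hx]
    nlinarith [abs_nonneg (μ (ζ k)), abs_nonneg (ζ k), mul_nonneg (abs_nonneg (μ (ζ k))) (abs_nonneg (ζ k))]
  have := emLG_union (emLG_union (emLG_lip h1) (emLG_lip h2)) (emLG_union (emLG_iUnion h3) (emLG_iUnion h4))
  obtain ⟨L, hL, hb⟩ := this
  refine ⟨L, hL, fun x _ => hb x ?_⟩
  by_cases hx0 : x < ζ ⟨0, hm⟩
  · exact Or.inl (Or.inl hx0)
  push Not at hx0
  classical
  let s : Finset (Fin m) := Finset.univ.filter fun k => ζ k ≤ x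
  have hs : s.Nonempty := ⟨⟨0, hm⟩, by simp [s, hx0]⟩
  have hmem := Finset.max'_mem s hs
  have hmax := fun j hj => Finset.le_max' s j hj
  set k := s.max' hs with hk
  have hkx : ζ k ≤ x := by simpa [s] using hmem
  rcases hkx.eq_or_lt with he | hlt
  · exact Or.inr (Or.inr (Set.mem_iUnion.2 ⟨k, by simp [he]⟩))
  by_cases h : (k : ℕ) + 1 < m
  · refine Or.inr (Or.inl (Set.mem_iUnion.2 ⟨k, ?_⟩))
    rw [dif_pos h]
    refine ⟨hlt, ?_⟩
    by_contra hcon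
    push Not at hcon
    have := hmax ⟨(k:ℕ) + 1, h⟩ (by simp [s, hcon])
    have := Fin.le_def.1 this
    simp only at this
    have h5 : (k : ℕ) + 1 ≤ (k : ℕ) := this
    omega
  · refine Or.inl (Or.inr ?_)
    have : k = ⟨m - 1, Nat.sub_lt hm one_pos⟩ := by
      apply Fin.ext; simp only; have := k.2; omega
    rw [Set.mem_Ioi, ← this]; exact hlt

lemma emLG_pow {f : ℝ → ℝ} (h : emLG f Set.univ) {p : ℝ} (hp : 0 ≤ p) :
    ∃ L : ℝ, 0 ≤ L ∧ ∀ x, |f x| ^ p ≤ L * (1 + |x| ^ p) := by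
  obtain ⟨L, hL, hb⟩ := h
  refine ⟨L ^ p * 3 ^ p, by positivity, fun x => ?_⟩
  have h1 := Real.rpow_le_rpow (abs_nonneg _) (hb x trivial) hp
  rw [Real.mul_rpow hL (by positivity)] at h1
  have h2 := em_sum3 hp 1 |x| 0
  rw [add_zero, abs_of_nonneg (by positivity : 0 ≤ 1 + |x|), abs_one, Real.one_rpow, abs_abs, abs_zero] at h2
  have h3 : (1 + |x|) ^ p ≤ 3 ^ p * (1 + |x| ^ p) ∨ p = 0 := by
    rcases hp.eq_or_lt with h | h
    · exact Or.inr h.symm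
    · rw [Real.zero_rpow h.ne', add_zero] at h2
      exact Or.inl h2
  rcases h3 with h3 | rfl
  · calc _ ≤ _ := h1
      _ ≤ L ^ p * (3 ^ p * (1 + |x| ^ p)) := by gcongr
      _ = _ := by ring
  · simp

set_option maxHeartbeats 2000000 in
/-- One step estimate for random data measurable at the left end point. -/
lemma em_step {Ω : Type*} {m0 : MeasurableSpace Ω} (P : Measure Ω) [IsProbabilityMeasure P]
    (F : Filtration ℝ m0) (μ σ ρ : ℝ → ℝ) (hμ : Measurable μ) (hσ : Measurable σ) (hρ : Measurable ρ)
    (gμ : emLG μ Set.univ) (gσ : emLG σ Set.univ) (gρ : emLG ρ Set.univ)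
    {p : ℝ} (hp : 2 ≤ p) (L : ℝ) (hL : 0 ≤ L) : ∃ C : ℝ, 0 < C ∧
    ∀ (τ : ℝ) (G K : Ω → ℝ) (h r : ℝ),
    Measurable G → Measurable K → 0 ≤ h → h ≤ 1 → 0 ≤ r → r ≤ L * h →
    Measure.map G P = gaussianReal 0 (Real.toNNReal h) →
    Measure.map K P = Measure.map (fun k : ℕ => (k : ℝ)) (poissonMeasure (Real.toNNReal r)) →
    Indep (MeasurableSpace.comap (fun ω => (G ω, K ω)) inferInstance) (F τ) P →
    ∀ D X : Ω → ℝ, Measurable[F τ] D → Measurable[F τ] X →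
    ∫⁻ ω, ENNReal.ofReal (|D ω + (μ (X ω) * h + σ (X ω) * G ω + ρ (X ω) * K ω)| ^ p) ∂P
      ≤ ENNReal.ofReal (1 + C * h) * ∫⁻ ω, ENNReal.ofReal (|D ω| ^ p) ∂P
        + ENNReal.ofReal (C * h) * (1 + ∫⁻ ω, ENNReal.ofReal (|X ω| ^ p) ∂P) := by
  obtain ⟨C, hC, hdet⟩ := em_det P hp L hL
  have hp0 : 0 ≤ p := by linarith
  obtain ⟨L1, hL1, b1⟩ := emLG_pow gμ hp0
  obtain ⟨L2, hL2, b2⟩ := emLG_pow gσ hp0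
  obtain ⟨L3, hL3, b3⟩ := emLG_pow gρ hp0
  set M := 1 + L1 + L2 + L3 with hM
  have hM1 : 1 ≤ M := by linarith
  refine ⟨C * M, by positivity, ?_⟩
  intro τ G K h r mG mK h0 h1 r0 r1 lG lK hind D X mD mX
  have mD' : Measurable D := mD.mono (F.le τ) le_rfl
  have mX' : Measurable X := mX.mono (F.le τ) le_rfl
  have mU : Measurable[F τ] (fun ω => (D ω, X ω)) := mD.prodMk mX
  have mU' : Measurable (fun ω => (D ω, X ω)) := mD'.prodMk mX'
  have mV : Measurable (fun ω => (G ω, K ω)) := mG.prodMk mK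
  have hi : IndepFun (fun ω => (D ω, X ω)) (fun ω => (G ω, K ω)) P := by
    rw [IndepFun_iff_Indep]
    exact indep_of_indep_of_le_left hind.symm mU.comap_le
  have hprod := (indepFun_iff_map_prod_eq_prod_map_map mU'.aemeasurable mV.aemeasurable).1 hi
  let f : (ℝ × ℝ) × (ℝ × ℝ) → ENNReal := fun q =>
    ENNReal.ofReal (|q.1.1 + (μ q.1.2 * h + σ q.1.2 * q.2.1 + ρ q.1.2 * q.2.2)| ^ p)
  have mf : Measurable f := by fun_prop
  calc ∫⁻ ω, ENNReal.ofReal (|D ω + (μ (X ω) * h + σ (X ω) * G ω + ρ (X ω) * K ω)| ^ p) ∂P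
      = ∫⁻ ω, f ((D ω, X ω), (G ω, K ω)) ∂P := rfl
    _ = ∫⁻ q, f q ∂((P.map (fun ω => (D ω, X ω))).prod (P.map (fun ω => (G ω, K ω)))) := by
        rw [← hprod, lintegral_map mf (mU'.prodMk mV)]
    _ = ∫⁻ ω, ∫⁻ ω', f ((D ω, X ω), (G ω', K ω')) ∂P ∂P := by
        rw [lintegral_prod _ mf.aemeasurable, lintegral_map mf.lintegral_prod_right' mU']
        refine lintegral_congr fun ω => ?_
        exact lintegral_map (mf.comp measurable_prodMk_left) mV
    _ ≤ ∫⁻ ω, (ENNReal.ofReal (1 + C * M * h) * ENNReal.ofReal (|D ω| ^ p)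
          + ENNReal.ofReal (C * M * h) * (1 + ENNReal.ofReal (|X ω| ^ p))) ∂P := by
        refine lintegral_mono fun ω => ?_
        refine (hdet G K h r mG mK h0 h1 r0 r1 lG lK (D ω) (μ (X ω)) (σ (X ω)) (ρ (X ω))).trans ?_
        have hd : 0 ≤ |D ω| ^ p := by positivity
        have hx : 0 ≤ |X ω| ^ p := by positivity
        rw [← ENNReal.ofReal_one, ← ENNReal.ofReal_add (by positivity) hx,
          ← ENNReal.ofReal_mul (by positivity), ← ENNReal.ofReal_mul (by positivity),
          ← ENNReal.ofReal_add (by positivity) (by positivity)]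
        apply ENNReal.ofReal_le_ofReal
        have c1 := b1 (X ω)
        have c2 := b2 (X ω)
        have c3 := b3 (X ω)
        have : |D ω| ^ p + |μ (X ω)| ^ p + |σ (X ω)| ^ p + |ρ (X ω)| ^ p
            ≤ M * (|D ω| ^ p + (1 + |X ω| ^ p)) := by
          have : |D ω| ^ p ≤ M * |D ω| ^ p := by nlinarith
          have : M * (1 + |X ω| ^ p) = (1 + |X ω| ^ p) + L1 * (1 + |X ω| ^ p) + L2 * (1 + |X ω| ^ p)
            + L3 * (1 + |X ω| ^ p) := by rw [hM]; ring
          linarith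
        have := mul_le_mul_of_nonneg_left this (by positivity : 0 ≤ C * h)
        linarith
    _ = _ := by
        rw [lintegral_add_left (by fun_prop), lintegral_const_mul _ (by fun_prop),
          lintegral_const_mul _ (by fun_prop), lintegral_add_left (by fun_prop)]
        simp

lemma em_cell {Ω : Type*} (μ σ ρ : ℝ → ℝ) (W N : ℝ → Ω → ℝ) (δ x : ℝ) (hδ : 0 < δ) (j : ℕ) (t : ℝ)
    (h1 : (j : ℝ) * δ ≤ t) (h2 : t ≤ ((j : ℝ) + 1) * δ) (ω : Ω) :
    emProc μ σ ρ W N δ x t ω = emGrid μ σ ρ W N δ x j ω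
      + μ (emGrid μ σ ρ W N δ x j ω) * (t - j * δ)
      + σ (emGrid μ σ ρ W N δ x j ω) * (W t ω - W (j * δ) ω)
      + ρ (emGrid μ σ ρ W N δ x j ω) * (N t ω - N (j * δ) ω) := by
  rcases h2.eq_or_lt with h | h
  · have hf : ⌊t / δ⌋.toNat = j + 1 := by
      have : t / δ = ((j + 1 : ℕ) : ℝ) := by rw [h]; push_cast; field_simp
      rw [this, Int.floor_natCast, Int.toNat_natCast]
    unfold emProc lastGrid
    rw [hf]
    have ht : ((j + 1 : ℕ) : ℝ) * δ = t := by rw [h]; push_cast; ring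
    rw [ht, sub_self, sub_self, sub_self, emGrid, ← h]
    have : t - j * δ = δ := by rw [h]; ring
    rw [this]; ring
  · have hf : ⌊t / δ⌋.toNat = j := by
      have : ⌊t / δ⌋ = (j : ℤ) := by
        rw [Int.floor_eq_iff]
        push_cast
        exact ⟨by rw [le_div_iff₀ hδ]; exact h1, by rw [div_lt_iff₀ hδ]; exact h⟩
      rw [this, Int.toNat_natCast]
    unfold emProc lastGrid
    rw [hf]

lemma em_grid_eq {Ω : Type*} (μ σ ρ : ℝ → ℝ) (W N : ℝ → Ω → ℝ) (δ x : ℝ) (hδ : 0 < δ) (j : ℕ) (ω : Ω) :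
    emProc μ σ ρ W N δ x (j * δ) ω = emGrid μ σ ρ W N δ x j ω := by
  rw [em_cell μ σ ρ W N δ x hδ j (j * δ) le_rfl (by nlinarith)]
  simp

lemma em_exists_cell (δ t : ℝ) (hδ : 0 < δ) (ht : 0 ≤ t) :
    ∃ j : ℕ, (j : ℝ) * δ ≤ t ∧ t ≤ ((j : ℝ) + 1) * δ := by
  refine ⟨⌊t / δ⌋₊, ?_, ?_⟩
  · rw [← le_div_iff₀ hδ]; exact Nat.floor_le (by positivity)
  · rw [← div_le_iff₀ hδ]; exact (Nat.lt_floor_add_one _).le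

/-- Time regularity of the Euler–Maruyama scheme:
`E[|X^{(δ)}_t - X^{(δ)}_s|^p] ≤ C (t - s)` uniformly in `δ = T/n ∈ (0,1)`. -/
theorem em_time_regularity
    {Ω : Type*} {m0 : MeasurableSpace Ω}
    (F : Filtration ℝ m0) (P : Measure Ω) [IsProbabilityMeasure P]
    (T : ℝ) (hT : 0 < T)
    (lam : ℝ → ℝ) (hlam_meas : Measurable lam)
    (hlam_pos : ∀ t ∈ Set.Icc (0:ℝ) T, 0 < lam t)
    (lamB : ℝ) (hlamB : ∀ t ∈ Set.Icc (0:ℝ) T, lam t ≤ lamB)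
    (W N : ℝ → Ω → ℝ)
    (hW0 : ∀ ω, W 0 ω = 0) (hN0 : ∀ ω, N 0 ω = 0)
    (hW_adapted : ∀ t ∈ Set.Icc (0:ℝ) T, Measurable[F t] (W t))
    (hN_adapted : ∀ t ∈ Set.Icc (0:ℝ) T, Measurable[F t] (N t))
    (hW_cont : ∀ᵐ ω ∂P, ContinuousOn (fun t => W t ω) (Set.Icc 0 T))
    (hN_mono : ∀ᵐ ω ∂P, ∀ s t : ℝ, 0 ≤ s → s ≤ t → t ≤ T → N s ω ≤ N t ω)
    (hN_rc : ∀ᵐ ω ∂P, ∀ t ∈ Set.Ico (0:ℝ) T,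
      Filter.Tendsto (fun u => N u ω) (nhdsWithin t (Set.Ioi t)) (nhds (N t ω)))
    (hN_int : ∀ᵐ ω ∂P, ∀ t ∈ Set.Icc (0:ℝ) T, ∃ k : ℕ, N t ω = k)
    (hW_gauss : ∀ s t : ℝ, 0 ≤ s → s ≤ t → t ≤ T →
      Measure.map (fun ω => W t ω - W s ω) P = gaussianReal 0 (Real.toNNReal (t - s)))
    (hN_poisson : ∀ s t : ℝ, 0 ≤ s → s ≤ t → t ≤ T →
      Measure.map (fun ω => N t ω - N s ω) P
        = Measure.map (fun k : ℕ => (k : ℝ))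
            (poissonMeasure (Real.toNNReal (∫ u in s..t, lam u))))
    (h_indep : ∀ s t : ℝ, 0 ≤ s → s ≤ t → t ≤ T →
      Indep (MeasurableSpace.comap (fun ω => (W t ω - W s ω, N t ω - N s ω)) inferInstance)
        (F s) P)
    (hWN_indep : ∀ s t : ℝ, 0 ≤ s → s ≤ t → t ≤ T →
      IndepFun (fun ω => W t ω - W s ω) (fun ω => N t ω - N s ω) P)
    (μ σ ρ : ℝ → ℝ) (hμ_meas : Measurable μ) (hσ_meas : Measurable σ) (hρ_meas : Measurable ρ)
    (m : ℕ) (hm : 0 < m) (ζ : Fin m → ℝ) (hζ : StrictMono ζ)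
    (hμ_low : ∃ K : NNReal, LipschitzOnWith K μ (Set.Iio (ζ ⟨0, hm⟩)))
    (hμ_high : ∃ K : NNReal, LipschitzOnWith K μ (Set.Ioi (ζ ⟨m - 1, Nat.sub_lt hm one_pos⟩)))
    (hμ_mid : ∀ (k : Fin m) (h : (k : ℕ) + 1 < m),
      ∃ K : NNReal, LipschitzOnWith K μ (Set.Ioo (ζ k) (ζ ⟨(k : ℕ) + 1, h⟩)))
    (hσ_lip : ∃ K : NNReal, LipschitzWith K σ)
    (hσ_nz : ∀ k : Fin m, σ (ζ k) ≠ 0)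
    (hρ_lip : ∃ K : NNReal, LipschitzWith K ρ)
    (ξ : ℝ) (p : ℝ) (hp : 2 ≤ p) :
    ∃ C : ℝ, 0 < C ∧ ∀ n : ℕ, 0 < n → T / n < 1 → ∀ s t : ℝ,
      s ∈ Set.Icc (0:ℝ) T → t ∈ Set.Icc (0:ℝ) T → s < t →
      ∫⁻ ω, ENNReal.ofReal
          (|emProc μ σ ρ W N (T / n) ξ t ω - emProc μ σ ρ W N (T / n) ξ s ω| ^ p) ∂P
        ≤ ENNReal.ofReal (C * (t - s)) := by
  obtain ⟨K2, hK2⟩ := hσ_lip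
  obtain ⟨K3, hK3⟩ := hρ_lip
  have hB0 : 0 ≤ lamB := by
    have h0 : (0:ℝ) ∈ Set.Icc (0:ℝ) T := ⟨le_rfl, hT.le⟩
    exact ((hlam_pos 0 h0).trans_le (hlamB 0 h0)).le
  obtain ⟨C, hC, hstep⟩ := em_step P F μ σ ρ hμ_meas hσ_meas hρ_meas
    (emLG_mu μ m hm ζ hμ_low hμ_high hμ_mid) (emLG_lip (lipschitzOnWith_univ.2 hK2))
    (emLG_lip (lipschitzOnWith_univ.2 hK3)) hp lamB hB0
  have hp0 : 0 < p := by linarith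
  set M : ℝ := Real.exp (2 * C * T) * (1 + |ξ| ^ p) with hM
  have hM0 : 0 < M := by positivity
  refine ⟨Real.exp (C * T) * (C * M), by positivity, ?_⟩
  intro n hn hδ1
  have hn' : (0:ℝ) < n := by exact_mod_cast hn
  set δ : ℝ := T / n with hδ
  have hδ0 : 0 < δ := by positivity
  set X := emProc μ σ ρ W N δ ξ with hX
  set Y := emGrid μ σ ρ W N δ ξ with hY
  -- intensity bounds
  have hlamint : ∀ r t : ℝ, 0 ≤ r → r ≤ t → t ≤ T →
      0 ≤ ∫ u in r..t, lam u ∧ ∫ u in r..t, lam u ≤ lamB * (t - r) := by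
    intro r t hr hrt ht
    have hii : IntervalIntegrable lam volume r t := by
      rw [intervalIntegrable_iff_integrableOn_Ioc_of_le hrt]
      refine Measure.integrableOn_of_bounded (M := lamB) (by simp) hlam_meas.aestronglyMeasurable ?_
      refine (ae_restrict_iff' measurableSet_Ioc).2 (Filter.Eventually.of_forall fun u hu => ?_)
      have hu' : u ∈ Set.Icc (0:ℝ) T := ⟨hr.trans hu.1.le, hu.2.trans ht⟩
      rw [Real.norm_eq_abs, abs_of_pos (hlam_pos u hu')]
      exact hlamB u hu'
    constructor
    · apply intervalIntegral.integral_nonneg hrt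
      intro u hu
      exact (hlam_pos u ⟨hr.trans hu.1, hu.2.trans ht⟩).le
    · have := intervalIntegral.integral_mono_on hrt hii (intervalIntegrable_const (c := lamB))
        (fun u hu => hlamB u ⟨hr.trans hu.1, hu.2.trans ht⟩)
      rw [intervalIntegral.integral_const, smul_eq_mul] at this
      linarith
  -- measurability
  have hYm : ∀ j : ℕ, (j : ℝ) * δ ≤ T → Measurable[F (j * δ)] (Y j) := by
    intro j
    induction j with
    | zero =>
      intro _
      have : Y 0 = fun _ => ξ := by funext ω; simp only [hY, emGrid]
      rw [this]; exact measurable_const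
    | succ j ih =>
      intro hj
      have e : ((j + 1 : ℕ) : ℝ) * δ = ((j : ℝ) + 1) * δ := by push_cast; ring
      rw [e] at hj ⊢
      have hle : (j : ℝ) * δ ≤ ((j : ℝ) + 1) * δ := by nlinarith
      have h0 : 0 ≤ (j : ℝ) * δ := by positivity
      have i1 : Measurable[F (((j : ℝ) + 1) * δ)] (Y j) :=
        (ih (hle.trans hj)).mono (F.mono hle) le_rfl
      have i2 := hW_adapted (((j : ℝ) + 1) * δ) ⟨h0.trans hle, hj⟩
      have i3 := hN_adapted (((j : ℝ) + 1) * δ) ⟨h0.trans hle, hj⟩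
      have i4 := (hW_adapted ((j : ℝ) * δ) ⟨h0, hle.trans hj⟩).mono (F.mono hle) le_rfl
      have i5 := (hN_adapted ((j : ℝ) * δ) ⟨h0, hle.trans hj⟩).mono (F.mono hle) le_rfl
      have : Y (j + 1) = fun ω => Y j ω + μ (Y j ω) * δ
          + σ (Y j ω) * (W (((j : ℝ) + 1) * δ) ω - W ((j : ℝ) * δ) ω)
          + ρ (Y j ω) * (N (((j : ℝ) + 1) * δ) ω - N ((j : ℝ) * δ) ω) := by
        funext ω; simp only [hY, emGrid]
      rw [this]
      exact ((i1.add ((hμ_meas.comp i1).mul_const δ)).add ((hσ_meas.comp i1).mul (i2.sub i4))).add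
        ((hρ_meas.comp i1).mul (i3.sub i5))
  have hXm : ∀ t : ℝ, 0 ≤ t → t ≤ T → Measurable[F t] (X t) := by
    intro t h0 hT'
    obtain ⟨j, h1, h2⟩ := em_exists_cell δ t hδ0 h0
    have hj0 : 0 ≤ (j : ℝ) * δ := by positivity
    have i1 : Measurable[F t] (Y j) := (hYm j (h1.trans hT')).mono (F.mono h1) le_rfl
    have i2 := hW_adapted t ⟨h0, hT'⟩
    have i3 := hN_adapted t ⟨h0, hT'⟩
    have i4 := (hW_adapted ((j : ℝ) * δ) ⟨hj0, h1.trans hT'⟩).mono (F.mono h1) le_rfl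
    have i5 := (hN_adapted ((j : ℝ) * δ) ⟨hj0, h1.trans hT'⟩).mono (F.mono h1) le_rfl
    have : X t = fun ω => Y j ω + μ (Y j ω) * (t - j * δ)
          + σ (Y j ω) * (W t ω - W ((j : ℝ) * δ) ω)
          + ρ (Y j ω) * (N t ω - N ((j : ℝ) * δ) ω) := by
      funext ω; exact em_cell μ σ ρ W N δ ξ hδ0 j t h1 h2 ω
    rw [this]
    exact ((i1.add ((hμ_meas.comp i1).mul_const _)).add ((hσ_meas.comp i1).mul (i2.sub i4))).add
        ((hρ_meas.comp i1).mul (i3.sub i5))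
  -- the step within a cell
  have hcell : ∀ (j : ℕ) (r t : ℝ) (D : Ω → ℝ), (j : ℝ) * δ ≤ r → r ≤ t → t ≤ ((j : ℝ) + 1) * δ →
      t ≤ T → Measurable[F r] D →
      ∫⁻ ω, ENNReal.ofReal (|D ω + (X t ω - X r ω)| ^ p) ∂P
        ≤ ENNReal.ofReal (1 + C * (t - r)) * ∫⁻ ω, ENNReal.ofReal (|D ω| ^ p) ∂P
          + ENNReal.ofReal (C * (t - r)) * (1 + ∫⁻ ω, ENNReal.ofReal (|Y j ω| ^ p) ∂P) := by
    intro j r t D hjr hrt htj htT hD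
    have hj0 : 0 ≤ (j : ℝ) * δ := by positivity
    have hr0 : 0 ≤ r := hj0.trans hjr
    have hrT : r ≤ T := hrt.trans htT
    have hW1 := (hW_adapted t ⟨hr0.trans hrt, htT⟩).mono (F.le t) le_rfl
    have hW2 := (hW_adapted r ⟨hr0, hrT⟩).mono (F.le r) le_rfl
    have hN1 := (hN_adapted t ⟨hr0.trans hrt, htT⟩).mono (F.le t) le_rfl
    have hN2 := (hN_adapted r ⟨hr0, hrT⟩).mono (F.le r) le_rfl
    have key := hstep r (fun ω => W t ω - W r ω) (fun ω => N t ω - N r ω) (t - r)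
      (∫ u in r..t, lam u) (hW1.sub hW2) (hN1.sub hN2) (by linarith) (by nlinarith)
      (hlamint r t hr0 hrt htT).1 (hlamint r t hr0 hrt htT).2
      (hW_gauss r t hr0 hrt htT) (hN_poisson r t hr0 hrt htT) (h_indep r t hr0 hrt htT)
      D (Y j) hD ((hYm j (hjr.trans hrT)).mono (F.mono hjr) le_rfl)
    refine le_trans (le_of_eq ?_) key
    refine lintegral_congr fun ω => ?_
    have e1 : X t ω = _ := em_cell μ σ ρ W N δ ξ hδ0 j t (hjr.trans hrt) htj ω
    have e2 : X r ω = _ := em_cell μ σ ρ W N δ ξ hδ0 j r hjr (hrt.trans htj) ω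
    rw [e1, e2]
    congr 3
    ring
  -- moment bound
  have hmom : ∀ j : ℕ, (j : ℝ) * δ ≤ T →
      1 + ∫⁻ ω, ENNReal.ofReal (|Y j ω| ^ p) ∂P
        ≤ ENNReal.ofReal (Real.exp (2 * C * (j * δ)) * (1 + |ξ| ^ p)) := by
    intro j
    induction j with
    | zero =>
      intro _
      have : Y 0 = fun _ => ξ := by funext ω; simp only [hY, emGrid]
      rw [this]
      simp only [lintegral_const, measure_univ, mul_one, Nat.cast_zero, zero_mul, mul_zero,
        Real.exp_zero, one_mul]
      rw [ENNReal.ofReal_add zero_le_one (by positivity), ENNReal.ofReal_one]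
    | succ j ih =>
      intro hj
      have e : ((j + 1 : ℕ) : ℝ) * δ = ((j : ℝ) + 1) * δ := by push_cast; ring
      rw [e] at hj ⊢
      have hle : (j : ℝ) * δ ≤ ((j : ℝ) + 1) * δ := by nlinarith
      have ih' := ih (hle.trans hj)
      have hc := hcell j (j * δ) (((j : ℝ) + 1) * δ) (Y j) le_rfl hle le_rfl hj (hYm j (hle.trans hj))
      have e2 : ((j : ℝ) + 1) * δ - j * δ = δ := by ring
      rw [e2] at hc
      have e3 : ∀ ω, Y j ω + (X (((j : ℝ) + 1) * δ) ω - X ((j : ℝ) * δ) ω) = Y (j + 1) ω := by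
        intro ω
        have a1 : X ((j : ℝ) * δ) ω = Y j ω := em_grid_eq μ σ ρ W N δ ξ hδ0 j ω
        have a2 : X (((j + 1 : ℕ) : ℝ) * δ) ω = Y (j + 1) ω := em_grid_eq μ σ ρ W N δ ξ hδ0 (j + 1) ω
        rw [e] at a2
        rw [a1, a2]; ring
      simp only [e3] at hc
      set g := ∫⁻ ω, ENNReal.ofReal (|Y j ω| ^ p) ∂P
      set g' := ∫⁻ ω, ENNReal.ofReal (|Y (j + 1) ω| ^ p) ∂P
      have hCδ : 0 ≤ C * δ := by positivity
      calc 1 + g' ≤ 1 + (ENNReal.ofReal (1 + C * δ) * g + ENNReal.ofReal (C * δ) * (1 + g)) := by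
            gcongr
        _ ≤ ENNReal.ofReal (1 + C * δ) * (1 + g) + ENNReal.ofReal (C * δ) * (1 + g) := by
            rw [mul_add (ENNReal.ofReal (1 + C * δ)), mul_one, add_assoc]
            gcongr
            rw [← ENNReal.ofReal_one]
            exact ENNReal.ofReal_le_ofReal (by linarith)
        _ = ENNReal.ofReal (1 + 2 * C * δ) * (1 + g) := by
            rw [← add_mul, ← ENNReal.ofReal_add (by positivity) hCδ]
            congr 2; ring
        _ ≤ ENNReal.ofReal (Real.exp (2 * C * δ)) *
            ENNReal.ofReal (Real.exp (2 * C * (j * δ)) * (1 + |ξ| ^ p)) := by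
            gcongr
            linarith [Real.add_one_le_exp (2 * C * δ)]
        _ = _ := by
            rw [← ENNReal.ofReal_mul (by positivity), ← mul_assoc, ← Real.exp_add]
            congr 3; ring_nf
  have hmom' : ∀ j : ℕ, (j : ℝ) * δ ≤ T →
      1 + ∫⁻ ω, ENNReal.ofReal (|Y j ω| ^ p) ∂P ≤ ENNReal.ofReal M := by
    intro j hj
    refine (hmom j hj).trans (ENNReal.ofReal_le_ofReal ?_)
    rw [hM]
    gcongr
  intro s t hs ht hst
  have hs0 := hs.1
  -- propagation of the increment bound
  have hprop : ∀ (j : ℕ) (r t : ℝ), s ≤ r → (j : ℝ) * δ ≤ r → r ≤ t → t ≤ ((j : ℝ) + 1) * δ → t ≤ T →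
      ∫⁻ ω, ENNReal.ofReal (|X r ω - X s ω| ^ p) ∂P
        ≤ ENNReal.ofReal (Real.exp (C * (r - s)) * (C * M) * (r - s)) →
      ∫⁻ ω, ENNReal.ofReal (|X t ω - X s ω| ^ p) ∂P
        ≤ ENNReal.ofReal (Real.exp (C * (t - s)) * (C * M) * (t - s)) := by
    intro j r t hsr hjr hrt htj htT hb
    have hrT := hrt.trans htT
    have hc := hcell j r t (fun ω => X r ω - X s ω) hjr hrt htj htT
      ((hXm r (hs0.trans hsr) hrT).sub ((hXm s hs0 hs.2).mono (F.mono hsr) le_rfl))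
    have e : ∀ ω, X r ω - X s ω + (X t ω - X r ω) = X t ω - X s ω := fun ω => by ring
    simp only [e] at hc
    have htr : 0 ≤ t - r := by linarith
    have hrs : 0 ≤ r - s := by linarith
    calc _ ≤ _ := hc
      _ ≤ ENNReal.ofReal (1 + C * (t - r)) *
            ENNReal.ofReal (Real.exp (C * (r - s)) * (C * M) * (r - s))
          + ENNReal.ofReal (C * (t - r)) * ENNReal.ofReal M := by
          gcongr
          exact hmom' j (hjr.trans hrT)
      _ = ENNReal.ofReal ((1 + C * (t - r)) * (Real.exp (C * (r - s)) * (C * M) * (r - s))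
            + C * (t - r) * M) := by
          rw [← ENNReal.ofReal_mul (by positivity), ← ENNReal.ofReal_mul (by positivity),
            ← ENNReal.ofReal_add (by positivity) (by positivity)]
      _ ≤ _ := by
          apply ENNReal.ofReal_le_ofReal
          have a1 : 1 + C * (t - r) ≤ Real.exp (C * (t - r)) := by
            linarith [Real.add_one_le_exp (C * (t - r))]
          have a2 : Real.exp (C * (t - s)) = Real.exp (C * (t - r)) * Real.exp (C * (r - s)) := by
            rw [← Real.exp_add]; congr 1; ring
          have a3 : 1 ≤ Real.exp (C * (t - s)) :=
            Real.one_le_exp (mul_nonneg hC.le (by linarith))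
          have a4 : (1 + C * (t - r)) * (Real.exp (C * (r - s)) * (C * M) * (r - s))
              ≤ Real.exp (C * (t - r)) * (Real.exp (C * (r - s)) * (C * M) * (r - s)) := by gcongr
          have a5 : 1 * (C * (t - r) * M) ≤ Real.exp (C * (t - s)) * (C * (t - r) * M) := by gcongr
          have a6 : Real.exp (C * (t - s)) * (C * M) * (t - s)
              = Real.exp (C * (t - r)) * (Real.exp (C * (r - s)) * (C * M) * (r - s))
                + Real.exp (C * (t - s)) * (C * (t - r) * M) := by rw [a2]; ring
          linarith
  have hself : ∫⁻ ω, ENNReal.ofReal (|X s ω - X s ω| ^ p) ∂P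
        ≤ ENNReal.ofReal (Real.exp (C * (s - s)) * (C * M) * (s - s)) := by
    simp [hp0.ne']
  have hgrid : ∀ j : ℕ, s ≤ (j : ℝ) * δ → (j : ℝ) * δ ≤ T →
      ∫⁻ ω, ENNReal.ofReal (|X (j * δ) ω - X s ω| ^ p) ∂P
        ≤ ENNReal.ofReal (Real.exp (C * (j * δ - s)) * (C * M) * (j * δ - s)) := by
    intro j
    induction j with
    | zero =>
      intro h1 _
      have : ((0 : ℕ) : ℝ) * δ = s := by simp only [Nat.cast_zero, zero_mul] at h1 ⊢; linarith
      rw [this]; exact hself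
    | succ j ih =>
      intro h1 h2
      have e : ((j + 1 : ℕ) : ℝ) * δ = ((j : ℝ) + 1) * δ := by push_cast; ring
      rw [e] at h1 h2 ⊢
      have hle : (j : ℝ) * δ ≤ ((j : ℝ) + 1) * δ := by nlinarith
      rcases le_total s (j * δ) with h | h
      · exact hprop j (j * δ) _ h le_rfl hle le_rfl h2 (ih h (hle.trans h2))
      · exact hprop j s _ le_rfl h h1 le_rfl h2 hself
  have hfin : ∫⁻ ω, ENNReal.ofReal (|X t ω - X s ω| ^ p) ∂P
        ≤ ENNReal.ofReal (Real.exp (C * (t - s)) * (C * M) * (t - s)) := by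
    obtain ⟨j, h1, h2⟩ := em_exists_cell δ t hδ0 ht.1
    rcases le_total s (j * δ) with h | h
    · exact hprop j (j * δ) t h le_rfl h1 h2 ht.2 (hgrid j h (h1.trans ht.2))
    · exact hprop j s t le_rfl h hst.le h2 ht.2 hself
  refine hfin.trans (ENNReal.ofReal_le_ofReal ?_)
  have hts : 0 ≤ t - s := by linarith
  have : C * (t - s) ≤ C * T := by
    have := ht.2
    gcongr; linarith
  gcongr
end
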